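/- arXiv:math/0702595 — 9 statements merged into one kernel-verified Lean document; each statement's English description precedes it below -/
import Mathlib

section
/- Let d ≥ 2 and let J : ℂ^d → ℂ be twice continuously differentiable in a neighborhood of the point 𝐜 = (c, c, …, c) where c is a positive real number, and suppose J is symmetric, i.e., invariant under every permutation of the d coordinates, and that the d-th partial derivative satisfies J_d(𝐜) ≠ 0. Define the (d−1)×(d−1) complex matrix H by: for l ≠ m (with l, m < d), H_{lm} = (c_l c_m)/(c_d² J_d(𝐜)²) · ( J_m J_l + c_d (J_d J_{lm} − J_m J_{ld} − J_l J_{dm} + (J_l J_m / J_d) J_{dd}) ) evaluated at 𝐜, and H_{ll} = (c_l J_l)/(c_d J_d) + (c_l²/(c_d² J_d²)) · ( J_l² + c_d (J_d J_{ll} − 2 J_l J_{ld} + (J_l²/J_d) J_{dd}) ) evaluated at 𝐜, where here c_i = c for all i. Then det H = d · ( 1 + (c/J_d(𝐜)) · (J_{dd}(𝐜) − J_{d1}(𝐜)) )^{d−1}. -/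
theorem Equiv.Perm.exists_apply_eq_and_apply_eq {α : Type*} [DecidableEq α] {i j k l : α}
    (hij : i ≠ j) (hkl : k ≠ l) : ∃ σ : Equiv.Perm α, σ i = k ∧ σ j = l := by
  refine ⟨Equiv.swap (Equiv.swap i k j) l * Equiv.swap i k, ?_, by simp⟩
  rw [Equiv.Perm.mul_apply, Equiv.swap_apply_left]
  refine Equiv.swap_apply_of_ne_of_ne (fun h => hij ?_) hkl
  exact (Equiv.swap i k).injective (by rw [Equiv.swap_apply_left, ← h])

section SymmetricFunction

variable {𝕜 ι F : Type*} [NontriviallyNormedField 𝕜] [CompleteSpace 𝕜] [Fintype ι]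
  [DecidableEq ι] [NormedAddCommGroup F] [NormedSpace 𝕜 F]

/-- If `f (x ∘ σ) = g x` for all `x`, the partial derivatives of `f` and `g` are related by the
same permutation of the coordinates. -/
theorem fderiv_single_of_comp_perm {f g : (ι → 𝕜) → F} (σ : Equiv.Perm ι)
    (h : ∀ x, f (x ∘ σ) = g x) (x : ι → 𝕜) (i : ι) :
    fderiv 𝕜 g x (Pi.single (σ i) 1) = fderiv 𝕜 f (x ∘ σ) (Pi.single i 1) := by
  let P : (ι → 𝕜) ≃L[𝕜] (ι → 𝕜) := (LinearEquiv.funCongrLeft 𝕜 𝕜 σ).toContinuousLinearEquiv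
  have hP : ∀ y, P y = y ∘ σ := fun _ => rfl
  have hg : g = f ∘ P := funext fun y => (h y).symm
  rw [hg, P.comp_right_fderiv, ContinuousLinearMap.comp_apply, hP]
  congr 1
  change P (Pi.single (σ i) 1) = _
  ext k
  simp [hP, Pi.single_apply]

/-- The first partial derivatives of a symmetric function agree at a diagonal point. -/
theorem fderiv_single_eq_of_symmetric {f : (ι → 𝕜) → F}
    (hf : ∀ (σ : Equiv.Perm ι) (x : ι → 𝕜), f (x ∘ σ) = f x) (c : 𝕜) (i j : ι) :
    fderiv 𝕜 f (fun _ => c) (Pi.single i 1) = fderiv 𝕜 f (fun _ => c) (Pi.single j 1) := by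
  have h := fderiv_single_of_comp_perm (Equiv.swap i j) (hf _) (fun _ => c) j
  rwa [Equiv.swap_apply_right] at h

/-- At a diagonal point, the second partial derivatives of a symmetric function are invariant
under permutations of the indices. -/
theorem fderiv_fderiv_single_perm_of_symmetric {f : (ι → 𝕜) → F}
    (hf : ∀ (σ : Equiv.Perm ι) (x : ι → 𝕜), f (x ∘ σ) = f x) (c : 𝕜) (σ : Equiv.Perm ι)
    (i j : ι) :
    fderiv 𝕜 (fun y => fderiv 𝕜 f y (Pi.single (σ i) 1)) (fun _ => c) (Pi.single (σ j) 1) =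
      fderiv 𝕜 (fun y => fderiv 𝕜 f y (Pi.single i 1)) (fun _ => c) (Pi.single j 1) :=
  fderiv_single_of_comp_perm σ
    (fun y => (fderiv_single_of_comp_perm σ (hf σ) y i).symm) (fun _ => c) j

end SymmetricFunction

theorem Matrix.det_of_ite_two_mul {n R : Type*} [Fintype n] [DecidableEq n] [CommRing R] (q : R) :
    (Matrix.of fun i j : n => if i = j then 2 * q else q).det =
      (Fintype.card n + 1) * q ^ Fintype.card n := by
  have h : (Matrix.of fun i j : n => if i = j then 2 * q else q) =
      q • (1 + Matrix.replicateCol Unit (1 : n → R) * Matrix.replicateRow Unit (1 : n → R)) := by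
    ext i j
    by_cases hij : i = j
    · simp [hij, Matrix.mul_apply]; ring
    · simp [hij, Matrix.mul_apply]
  rw [h, Matrix.det_smul, Matrix.det_one_add_replicateCol_mul_replicateRow]
  simp
  ring


/-- Proposition (symmetric Hessian determinant): if `J : ℂ^d → ℂ` is C² near the
diagonal point `C = (c,…,c)` with `c > 0`, symmetric under permutations of the
coordinates, and `J_d(C) ≠ 0`, then the determinant of the `(d−1)×(d−1)` matrix `H`
built from the first and second partial derivatives of `J` at `C` equals
`d · (1 + (c/J_d)(J_dd − J_d1))^(d−1)`. -/
theorem stmt0 (d : ℕ) (hd : 2 ≤ d) (c : ℝ) (hc : 0 < c)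
    (J : (Fin d → ℂ) → ℂ)
    (C : Fin d → ℂ) (hC : C = fun _ => (c : ℂ))
    (hJ : ContDiffAt ℂ 2 J C)
    (hsym : ∀ (σ : Equiv.Perm (Fin d)) (x : Fin d → ℂ), J (x ∘ σ) = J x)
    (pd : Fin d → ℂ)
    (hpd : ∀ i, pd i = fderiv ℂ J C (Pi.single i 1))
    (pd2 : Fin d → Fin d → ℂ)
    (hpd2 : ∀ i j, pd2 i j =
      fderiv ℂ (fun y => fderiv ℂ J y (Pi.single i 1)) C (Pi.single j 1))
    (dd i1 : Fin d) (hdd : dd = ⟨d - 1, by omega⟩) (hi1 : i1 = ⟨0, by omega⟩)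
    (hJd : pd dd ≠ 0)
    (e : Fin (d - 1) → Fin d) (he : e = Fin.castLE (Nat.sub_le d 1))
    (H : Matrix (Fin (d - 1)) (Fin (d - 1)) ℂ)
    (hH : ∀ l m : Fin (d - 1), H l m =
      if l = m then
        ((c : ℂ) * pd (e l)) / ((c : ℂ) * pd dd) +
          ((c : ℂ) ^ 2 / ((c : ℂ) ^ 2 * (pd dd) ^ 2)) *
            ((pd (e l)) ^ 2 + (c : ℂ) *
              (pd dd * pd2 (e l) (e l) - 2 * pd (e l) * pd2 (e l) dd +
                ((pd (e l)) ^ 2 / pd dd) * pd2 dd dd))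
      else
        ((c : ℂ) * (c : ℂ)) / ((c : ℂ) ^ 2 * (pd dd) ^ 2) *
          (pd (e m) * pd (e l) + (c : ℂ) *
            (pd dd * pd2 (e l) (e m) - pd (e m) * pd2 (e l) dd -
              pd (e l) * pd2 dd (e m) +
                ((pd (e l) * pd (e m)) / pd dd) * pd2 dd dd))) :
    H.det = (d : ℂ) * (1 + ((c : ℂ) / pd dd) * (pd2 dd dd - pd2 dd i1)) ^ (d - 1) := by
  subst hC
  have hc0 : (c : ℂ) ≠ 0 := by exact_mod_cast hc.ne'
  have hne : dd ≠ i1 := by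
    rw [hdd, hi1, Ne, Fin.mk.injEq]
    omega
  have hpd_eq : ∀ i, pd i = pd dd := fun i => by
    rw [hpd, hpd]
    exact fderiv_single_eq_of_symmetric hsym _ i dd
  have hperm : ∀ (σ : Equiv.Perm (Fin d)) i j, pd2 (σ i) (σ j) = pd2 i j := fun σ i j => by
    rw [hpd2, hpd2]
    exact fderiv_fderiv_single_perm_of_symmetric hsym _ σ i j
  have hdiag : ∀ i, pd2 i i = pd2 dd dd := fun i => by
    simpa using hperm (Equiv.swap dd i) dd dd
  have hoff : ∀ i j, i ≠ j → pd2 i j = pd2 dd i1 := fun i j hij => by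
    obtain ⟨σ, rfl, rfl⟩ := Equiv.Perm.exists_apply_eq_and_apply_eq hne hij
    exact hperm σ dd i1
  have he_ne : ∀ l, e l ≠ dd := fun l h => by
    have := congrArg Fin.val h
    rw [he, hdd] at this
    simp only [Fin.val_castLE] at this
    omega
  have he_inj : Function.Injective e := by
    rw [he]
    exact Fin.castLE_injective _
  have hH' : H = Matrix.of fun l m => if l = m then
      2 * (1 + ((c : ℂ) / pd dd) * (pd2 dd dd - pd2 dd i1)) else
      1 + ((c : ℂ) / pd dd) * (pd2 dd dd - pd2 dd i1) := by
    ext l m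
    rw [hH, Matrix.of_apply]
    split_ifs with hlm
    · rw [hdiag (e l), hoff _ _ (he_ne l), hpd_eq (e l)]
      field_simp
      ring
    · rw [hoff _ _ (he_inj.ne hlm), hoff _ _ (he_ne l), hoff _ _ (he_ne m).symm,
        hpd_eq (e l), hpd_eq (e m)]
      field_simp
      ring
  rw [hH', Matrix.det_of_ite_two_mul, Fintype.card_fin, Nat.cast_sub (by omega)]
  simp
end

section
/- Let d ≥ 2, let 𝐜 = (c_1,…,c_d) ∈ ℂ^d with all coordinates nonzero, and let J : ℂ^d → ℂ be twice continuously differentiable near 𝐜 with J_d(𝐜) ≠ 0. Write ĉ = (c_1,…,c_{d−1}) and let g be a differentiable complex-valued function defined near ĉ in ℂ^{d−1} with g(ĉ) = c_d and J(x̂, g(x̂)) = 0 for all x̂ near ĉ. Let φ : ℝ^{d−1} → ℂ be twice continuously differentiable near 0 with φ(0) = 0 and exp(φ(θ)) = g(c_1 e^{iθ_1}, …, c_{d−1} e^{iθ_{d−1}}) / c_d for all θ near 0. Then for all l ≠ m with l, m < d, the mixed second partial derivative ∂²φ/∂θ_l ∂θ_m at θ = 0 equals (c_l c_m)/(c_d²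 J_d(𝐜)²) · ( J_m J_l + c_d ( J_d J_{lm} − J_m J_{ld} − J_l J_{dm} + (J_l J_m / J_d) J_{dd} ) ) evaluated at 𝐜. -/
/-- The point of `ℂ^(d+1)` with coordinates `C i * exp (I * θ i)` for `i < d` and last coordinate
`C d * exp (φ θ)`. -/
noncomputable def torusLift {d : ℕ} (C : Fin (d + 1) → ℂ) (φ : (Fin d → ℝ) → ℂ)
    (θ : Fin d → ℝ) : Fin (d + 1) → ℂ :=
  Fin.snoc (α := fun _ => ℂ) (fun i => C i.castSucc * Complex.exp (Complex.I * (θ i : ℂ)))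
    (C (Fin.last d) * Complex.exp (φ θ))

theorem torusLift_zero {d : ℕ} (C : Fin (d + 1) → ℂ) {φ : (Fin d → ℝ) → ℂ} (hφ0 : φ 0 = 0) :
    torusLift C φ 0 = C := by
  funext j
  refine Fin.lastCases ?_ (fun j => ?_) j <;> simp [torusLift, hφ0]

theorem hasDerivAt_comp_add_smul {E F : Type*} [NormedAddCommGroup E] [NormedSpace ℝ E]
    [NormedAddCommGroup F] [NormedSpace ℝ F] {f : E → F} {x : E} (hf : DifferentiableAt ℝ f x)
    (v : E) : HasDerivAt (fun t : ℝ => f (x + t • v)) (fderiv ℝ f x v) 0 := by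
  have h : HasDerivAt (fun t : ℝ => x + t • v) v 0 := by
    simpa using ((hasDerivAt_id (0 : ℝ)).smul_const v).const_add x
  have hf' : HasFDerivAt f (fderiv ℝ f x) (x + (0 : ℝ) • v) := by
    simpa using hf.hasFDerivAt
  exact hf'.comp_hasDerivAt (0 : ℝ) h

theorem hasDerivAt_mul_exp_coord {d : ℕ} (c : ℂ) (θ : Fin d → ℝ) (j l : Fin d) :
    HasDerivAt (fun t : ℝ => c * Complex.exp
        (Complex.I * (((θ + t • (Pi.single l 1 : Fin d → ℝ)) j : ℝ) : ℂ)))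
      ((Pi.single l 1 : Fin d → ℂ) j * (Complex.I * (c * Complex.exp (Complex.I * (θ j : ℂ)))))
      0 := by
  have h : HasDerivAt (fun t : ℝ => (θ + t • (Pi.single l 1 : Fin d → ℝ)) j)
      ((Pi.single l 1 : Fin d → ℝ) j) 0 := by
    simpa using ((hasDerivAt_id (0 : ℝ)).mul_const
      ((Pi.single l 1 : Fin d → ℝ) j)).const_add (θ j)
  refine ((h.ofReal_comp.const_mul Complex.I).cexp.const_mul c).congr_deriv ?_
  by_cases hj : j = l
  · subst hj
    simp
    ring
  · simp [hj]

theorem hasDerivAt_torusLift {d : ℕ} (C : Fin (d + 1) → ℂ) {φ : (Fin d → ℝ) → ℂ}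
    {θ : Fin d → ℝ} (hφ : DifferentiableAt ℝ φ θ) (l : Fin d) :
    HasDerivAt (fun t : ℝ => torusLift C φ (θ + t • Pi.single l 1))
      ((Complex.I * (C l.castSucc * Complex.exp (Complex.I * (θ l : ℂ)))) •
          (Pi.single l.castSucc 1 : Fin (d + 1) → ℂ) +
        (C (Fin.last d) * Complex.exp (φ θ) * fderiv ℝ φ θ (Pi.single l 1)) •
          (Pi.single (Fin.last d) 1 : Fin (d + 1) → ℂ)) 0 := by
  rw [hasDerivAt_pi]
  intro j
  refine Fin.lastCases ?_ (fun j => ?_) j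
  · simp only [torusLift, Fin.snoc_last]
    refine ((hasDerivAt_comp_add_smul hφ (Pi.single l 1)).cexp.const_mul
      (C (Fin.last d))).congr_deriv ?_
    simp [(Fin.castSucc_lt_last l).ne']
    ring
  · simp only [torusLift, Fin.snoc_castSucc]
    refine (hasDerivAt_mul_exp_coord (C j.castSucc) θ j l).congr_deriv ?_
    by_cases hj : j = l
    · subst hj
      simp [(Fin.castSucc_lt_last j).ne]
    · simp [hj, (Fin.castSucc_lt_last j).ne]

theorem hasDerivAt_comp_torusLift {d : ℕ} (C : Fin (d + 1) → ℂ) {φ : (Fin d → ℝ) → ℂ}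
    {θ : Fin d → ℝ} (hφ : DifferentiableAt ℝ φ θ) {H : (Fin (d + 1) → ℂ) → ℂ}
    (hH : DifferentiableAt ℂ H (torusLift C φ θ)) (l : Fin d) :
    HasDerivAt (fun t : ℝ => H (torusLift C φ (θ + t • Pi.single l 1)))
      (Complex.I * (C l.castSucc * Complex.exp (Complex.I * (θ l : ℂ))) *
          fderiv ℂ H (torusLift C φ θ) (Pi.single l.castSucc 1) +
        C (Fin.last d) * Complex.exp (φ θ) * fderiv ℝ φ θ (Pi.single l 1) *
          fderiv ℂ H (torusLift C φ θ) (Pi.single (Fin.last d) 1)) 0 := by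
  have hH' : HasFDerivAt H ((fderiv ℂ H (torusLift C φ θ)).restrictScalars ℝ)
      (torusLift C φ (θ + (0 : ℝ) • Pi.single l 1)) := by
    simpa using hH.hasFDerivAt.restrictScalars ℝ
  refine (hH'.comp_hasDerivAt (0 : ℝ) (hasDerivAt_torusLift C hφ l)).congr_deriv ?_
  rw [ContinuousLinearMap.coe_restrictScalars', map_add, map_smul, map_smul, smul_eq_mul,
    smul_eq_mul]


/-- Mixed second partial derivative (l ≠ m) at θ = 0 of a branch φ of
θ ↦ log(g(c₁e^{iθ₁},…,c_{d-1}e^{iθ_{d-1}})/c_d), where g is the implicit function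
with J(x̂, g(x̂)) = 0 near ĉ. -/
theorem stmt2 (d : ℕ) (hd : 1 ≤ d)
    (C : Fin (d + 1) → ℂ) (hC : ∀ i, C i ≠ 0)
    (J : (Fin (d + 1) → ℂ) → ℂ)
    (hJ : ContDiffAt ℂ 2 J C)
    (pd : Fin (d + 1) → ℂ)
    (hpd : ∀ i, pd i = fderiv ℂ J C (Pi.single i 1))
    (pd2 : Fin (d + 1) → Fin (d + 1) → ℂ)
    (hpd2 : ∀ i j, pd2 i j =
      fderiv ℂ (fun y => fderiv ℂ J y (Pi.single i 1)) C (Pi.single j 1))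
    (hJd : pd (Fin.last d) ≠ 0)
    (Chat : Fin d → ℂ) (hChat : ∀ i, Chat i = C i.castSucc)
    (g : (Fin d → ℂ) → ℂ)
    (hg0 : g Chat = C (Fin.last d))
    (hgdiff : ∀ᶠ x in nhds Chat, DifferentiableAt ℂ g x)
    (hgz : ∀ᶠ x in nhds Chat, J (Fin.snoc x (g x)) = 0)
    (φ : (Fin d → ℝ) → ℂ)
    (hφ : ContDiffAt ℝ 2 φ 0) (hφ0 : φ 0 = 0)
    (hφg : ∀ᶠ θ in nhds (0 : Fin d → ℝ), Complex.exp (φ θ) =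
      g (fun i => C i.castSucc * Complex.exp (Complex.I * (θ i : ℂ))) / C (Fin.last d))
    (l m : Fin d) (hlm : l ≠ m) :
    fderiv ℝ (fun θ => fderiv ℝ φ θ (Pi.single l 1)) 0 (Pi.single m 1) =
      (C l.castSucc * C m.castSucc) / ((C (Fin.last d)) ^ 2 * (pd (Fin.last d)) ^ 2) *
        (pd m.castSucc * pd l.castSucc + C (Fin.last d) *
          (pd (Fin.last d) * pd2 l.castSucc m.castSucc
            - pd m.castSucc * pd2 l.castSucc (Fin.last d)
            - pd l.castSucc * pd2 (Fin.last d) m.castSucc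
            + (pd l.castSucc * pd m.castSucc / pd (Fin.last d))
                * pd2 (Fin.last d) (Fin.last d))) := by
  have hCd := hC (Fin.last d)
  have hX0 : torusLift C φ 0 = C := torusLift_zero C hφ0
  have hφd : ∀ᶠ θ in nhds (0 : Fin d → ℝ), DifferentiableAt ℝ φ θ :=
    (hφ.eventually (by simp)).mono fun θ h => h.differentiableAt (by simp)
  have hφ1 : ∀ v, DifferentiableAt ℝ (fun θ => fderiv ℝ φ θ v) 0 := fun v =>
    ((hφ.fderiv_right (m := 1) (by norm_num)).differentiableAt (by simp)).clm_apply
      (differentiableAt_const v)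
  have hJ1 : ∀ v, DifferentiableAt ℂ (fun y => fderiv ℂ J y v) C := fun v =>
    ((hJ.fderiv_right (m := 1) (by norm_num)).differentiableAt (by simp)).clm_apply
      (differentiableAt_const v)
  have hXc : Filter.Tendsto (torusLift C φ) (nhds 0) (nhds C) := by
    have hc : ContinuousAt (torusLift C φ) 0 := by
      rw [continuousAt_pi]
      intro j
      have hφc := hφ.continuousAt
      refine Fin.lastCases ?_ (fun j => ?_) j
      · simp only [torusLift, Fin.snoc_last]
        fun_prop
      · simp only [torusLift, Fin.snoc_castSucc]
        exact Continuous.continuousAt (by fun_prop)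
    simpa [ContinuousAt, hX0] using hc
  have hJd' : ∀ᶠ θ in nhds (0 : Fin d → ℝ), DifferentiableAt ℂ J (torusLift C φ θ) :=
    hXc.eventually ((hJ.eventually (by simp)).mono fun y h => h.differentiableAt (by simp))
  have hJ0 : ∀ᶠ θ in nhds (0 : Fin d → ℝ), J (torusLift C φ θ) = 0 := by
    have hcont : Filter.Tendsto (fun (θ : Fin d → ℝ) (i : Fin d) =>
        C i.castSucc * Complex.exp (Complex.I * (θ i : ℂ))) (nhds 0) (nhds Chat) := by
      have hc : Continuous (fun (θ : Fin d → ℝ) (i : Fin d) =>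
        C i.castSucc * Complex.exp (Complex.I * (θ i : ℂ))) := by fun_prop
      have h := hc.tendsto 0
      have hz : (fun i : Fin d => C i.castSucc *
          Complex.exp (Complex.I * (((0 : Fin d → ℝ) i : ℝ) : ℂ))) = Chat := by
        funext i
        simp [hChat]
      rwa [hz] at h
    filter_upwards [hcont.eventually hgz, hφg] with θ h1 h2
    rw [torusLift, h2, mul_div_cancel₀ _ hCd]
    exact h1
  have hfirst : ∀ k : Fin d, ∀ᶠ θ in nhds (0 : Fin d → ℝ),
      Complex.I * (C k.castSucc * Complex.exp (Complex.I * (θ k : ℂ))) *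
          fderiv ℂ J (torusLift C φ θ) (Pi.single k.castSucc 1) +
        C (Fin.last d) * Complex.exp (φ θ) * fderiv ℝ φ θ (Pi.single k 1) *
          fderiv ℂ J (torusLift C φ θ) (Pi.single (Fin.last d) 1) = 0 := by
    intro k
    filter_upwards [hφd, hJd', hJ0.eventually_nhds] with θ h1 h2 h3
    have hline : Filter.Tendsto (fun t : ℝ => θ + t • (Pi.single k 1 : Fin d → ℝ)) (nhds 0)
        (nhds θ) := by
      have hc : Continuous (fun t : ℝ => θ + t • (Pi.single k 1 : Fin d → ℝ)) := by fun_prop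
      simpa using hc.tendsto 0
    exact (hasDerivAt_comp_torusLift C h1 h2 k).unique
      ((hasDerivAt_const (0 : ℝ) (0 : ℂ)).congr_of_eventuallyEq (hline.eventually h3))
  have hline : Filter.Tendsto (fun t : ℝ => (0 : Fin d → ℝ) + t • (Pi.single m 1 : Fin d → ℝ))
      (nhds 0) (nhds 0) := by
    have hc : Continuous (fun t : ℝ => (0 : Fin d → ℝ) + t • (Pi.single m 1 : Fin d → ℝ)) := by
      fun_prop
    simpa using hc.tendsto 0
  have hA : ∀ i : Fin (d + 1), HasDerivAt (fun t : ℝ => fderiv ℂ J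
      (torusLift C φ (0 + t • Pi.single m 1)) (Pi.single i 1))
      (Complex.I * C m.castSucc * pd2 i m.castSucc +
        C (Fin.last d) * fderiv ℝ φ 0 (Pi.single m 1) * pd2 i (Fin.last d)) 0 := by
    intro i
    have h := hasDerivAt_comp_torusLift C hφd.self_of_nhds
      (H := fun y => fderiv ℂ J y (Pi.single i 1)) (by rw [hX0]; exact hJ1 _) m
    simpa [hX0, hφ0, ← hpd2] using h
  have hx := hasDerivAt_mul_exp_coord (C l.castSucc) 0 l m
  have hG := (hasDerivAt_comp_add_smul hφd.self_of_nhds (Pi.single m 1)).cexp.const_mul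
    (C (Fin.last d))
  have hF := hasDerivAt_comp_add_smul (hφ1 (Pi.single l 1)) (Pi.single m 1)
  have hE := (((hx.const_mul Complex.I).mul (hA l.castSucc)).add
    ((hG.mul hF).mul (hA (Fin.last d)))).unique
    ((hasDerivAt_const (0 : ℝ) (0 : ℂ)).congr_of_eventuallyEq (hline.eventually (hfirst l)))
  have h1 : ∀ k : Fin d, fderiv ℝ φ 0 (Pi.single k 1) =
      -(Complex.I * C k.castSucc * pd k.castSucc) / (C (Fin.last d) * pd (Fin.last d)) := by
    intro k
    have h := (hfirst k).self_of_nhds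
    simp only [hX0, hφ0, ← hpd, Pi.zero_apply, Complex.ofReal_zero, mul_zero, Complex.exp_zero,
      mul_one] at h
    rw [eq_div_iff (mul_ne_zero hCd hJd)]
    linear_combination h
  simp only [zero_smul, add_zero, hX0, hφ0, ← hpd, Pi.zero_apply, Complex.ofReal_zero, mul_zero,
    Complex.exp_zero, mul_one, Pi.single_eq_of_ne hlm, zero_mul, zero_add, one_mul, h1,
    Pi.mul_apply] at hE
  generalize fderiv ℝ (fun θ => fderiv ℝ φ θ (Pi.single l 1)) 0 (Pi.single m 1) = D at hE ⊢
  generalize pd (Fin.last d) = p at *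
  generalize C (Fin.last d) = c at *
  field_simp at hE ⊢
  rw [Complex.I_sq] at hE
  linear_combination hE
end

section
/- Let d ≥ 2, let 𝐜 = (c_1,…,c_d) ∈ ℂ^d with all coordinates nonzero, and let J : ℂ^d → ℂ be twice continuously differentiable near 𝐜 with J_d(𝐜) ≠ 0. Write ĉ = (c_1,…,c_{d−1}) and let g be a differentiable complex-valued function defined near ĉ in ℂ^{d−1} with g(ĉ) = c_d and J(x̂, g(x̂)) = 0 for all x̂ near ĉ. Let φ : ℝ^{d−1} → ℂ be twice continuously differentiable near 0 with φ(0) = 0 and exp(φ(θ)) = g(c_1 e^{iθ_1}, …, c_{d−1} e^{iθ_{d−1}}) / c_d for all θ near 0. Then for each l < d, the second partial derivative ∂²φ/∂θ_l² at θ = 0 equals (c_l J_l)/(c_d J_d) + (c_l²/(c_d² J_d²)) · ( J_l² + c_d ( J_d J_{ll} − 2 J_l J_{ld} + (J_l²/J_d) J_{dd} ) ) evaluated at 𝐜. -/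
/-- Chain rule along the real line `t ↦ t • e`. -/
theorem hasDerivAt_comp_smul {E F : Type*} [NormedAddCommGroup E] [NormedSpace ℝ E]
    [NormedAddCommGroup F] [NormedSpace ℝ F] {f : E → F} {e : E} {t : ℝ}
    (hf : DifferentiableAt ℝ f (t • e)) :
    HasDerivAt (fun s : ℝ => f (s • e)) (fderiv ℝ f (t • e) e) t := by
  have h := hf.hasFDerivAt.comp_hasDerivAt t ((hasDerivAt_id t).smul_const e)
  simpa [Function.comp_def] using h

/-- Chain rule for a complex differentiable function along a real curve. -/
theorem DifferentiableAt.hasDerivAt_comp_real {E F : Type*} [NormedAddCommGroup E]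
    [NormedSpace ℂ E] [NormedAddCommGroup F] [NormedSpace ℂ F] {f : E → F} {γ : ℝ → E} {v : E}
    {t : ℝ} (hf : DifferentiableAt ℂ f (γ t)) (hγ : HasDerivAt γ v t) :
    HasDerivAt (fun s : ℝ => f (γ s)) (fderiv ℂ f (γ t) v) t :=
  (hf.hasFDerivAt.restrictScalars ℝ).comp_hasDerivAt t hγ

open Filter Topology in
/-- Differentiating `J (C + (u t - u 0) • e + (w t - w 0) • f) = 0` twice at `t = 0`. -/
theorem second_deriv_of_vanishing_curve {E : Type*} [NormedAddCommGroup E] [NormedSpace ℂ E]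
    {J : E → ℂ} {C e f : E} (hJ : ContDiffAt ℂ 2 J C) {u u' w w' : ℝ → ℂ} {u'' w'' : ℂ}
    (hu : ∀ᶠ t in 𝓝 0, HasDerivAt u (u' t) t) (hu' : HasDerivAt u' u'' 0)
    (hw : ∀ᶠ t in 𝓝 0, HasDerivAt w (w' t) t) (hw' : HasDerivAt w' w'' 0)
    (hz : ∀ᶠ t in 𝓝 0, J (C + (u t - u 0) • e + (w t - w 0) • f) = 0) :
    u' 0 * fderiv ℂ J C e + w' 0 * fderiv ℂ J C f = 0 ∧
    u'' * fderiv ℂ J C e + w'' * fderiv ℂ J C f +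
      u' 0 ^ 2 * fderiv ℂ (fun y => fderiv ℂ J y e) C e +
      2 * u' 0 * w' 0 * fderiv ℂ (fun y => fderiv ℂ J y e) C f +
      w' 0 ^ 2 * fderiv ℂ (fun y => fderiv ℂ J y f) C f = 0 := by
  have hdJ : DifferentiableAt ℂ (fderiv ℂ J) C :=
    (hJ.fderiv_right (m := 1) (by norm_num [one_add_one_eq_two])).differentiableAt (by norm_num)
  have hev : ∀ᶠ y in 𝓝 C, DifferentiableAt ℂ J y :=
    (hJ.eventually (by simp)).mono fun y hy => hy.differentiableAt (by norm_num)
  have happ (v : E) : DifferentiableAt ℂ (fun y => fderiv ℂ J y v) C :=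
    hdJ.clm_apply (differentiableAt_const v)
  have hsnd (v x : E) : fderiv ℂ (fun y => fderiv ℂ J y v) C x
      = fderiv ℂ (fderiv ℂ J) C x v := by
    rw [fderiv_clm_apply hdJ (differentiableAt_const v)]
    simp
  have hsymm : fderiv ℂ (fun y => fderiv ℂ J y f) C e
      = fderiv ℂ (fun y => fderiv ℂ J y e) C f := by
    rw [hsnd, hsnd]
    exact hJ.isSymmSndFDerivAt (by simp) e f
  set γ : ℝ → E := fun t => C + (u t - u 0) • e + (w t - w 0) • f with hγdef
  have hγ0 : γ 0 = C := by simp [hγdef]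
  have hγ : ∀ᶠ t in 𝓝 0, HasDerivAt γ (u' t • e + w' t • f) t := by
    filter_upwards [hu, hw] with t h1 h2
    exact (((h1.sub_const (u 0)).smul_const e).const_add C).add
      ((h2.sub_const (w 0)).smul_const f)
  have hγc : Tendsto γ (𝓝 0) (𝓝 C) := by
    simpa only [ContinuousAt, hγ0] using hγ.self_of_nhds.continuousAt
  have hfirst : ∀ᶠ t in 𝓝 0,
      u' t * fderiv ℂ J (γ t) e + w' t * fderiv ℂ J (γ t) f = 0 := by
    filter_upwards [hγ, hγc.eventually hev, hz.eventually_nhds] with t h1 h2 h3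
    have h4 := (h2.hasDerivAt_comp_real h1).unique
      ((hasDerivAt_const t (0 : ℂ)).congr_of_eventuallyEq h3)
    simpa using h4
  have hfirst0 := hfirst.self_of_nhds
  rw [hγ0] at hfirst0
  refine ⟨hfirst0, ?_⟩
  have hD (v : E) : HasDerivAt (fun t => fderiv ℂ J (γ t) v)
      (fderiv ℂ (fun y => fderiv ℂ J y v) C (u' 0 • e + w' 0 • f)) 0 := by
    have h : DifferentiableAt ℂ (fun y => fderiv ℂ J y v) (γ 0) := hγ0 ▸ happ v
    simpa only [hγ0] using h.hasDerivAt_comp_real hγ.self_of_nhds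
  have hsum := ((hu'.mul (hD e)).add (hw'.mul (hD f))).unique
    ((hasDerivAt_const (0 : ℝ) (0 : ℂ)).congr_of_eventuallyEq hfirst)
  simp only [hγ0, map_add, map_smul, smul_eq_mul, hsymm] at hsum
  linear_combination hsum

open Filter Topology in

/-- Diagonal second partial derivative at θ = 0 of a branch φ of
θ ↦ log(g(c₁e^{iθ₁},…,c_{d-1}e^{iθ_{d-1}})/c_d), where g is the implicit function
with J(x̂, g(x̂)) = 0 near ĉ. -/
theorem stmt3 (d : ℕ) (hd : 1 ≤ d)
    (C : Fin (d + 1) → ℂ) (hC : ∀ i, C i ≠ 0)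
    (J : (Fin (d + 1) → ℂ) → ℂ)
    (hJ : ContDiffAt ℂ 2 J C)
    (pd : Fin (d + 1) → ℂ)
    (hpd : ∀ i, pd i = fderiv ℂ J C (Pi.single i 1))
    (pd2 : Fin (d + 1) → Fin (d + 1) → ℂ)
    (hpd2 : ∀ i j, pd2 i j =
      fderiv ℂ (fun y => fderiv ℂ J y (Pi.single i 1)) C (Pi.single j 1))
    (hJd : pd (Fin.last d) ≠ 0)
    (Chat : Fin d → ℂ) (hChat : ∀ i, Chat i = C i.castSucc)
    (g : (Fin d → ℂ) → ℂ)
    (hg0 : g Chat = C (Fin.last d))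
    (hgdiff : ∀ᶠ x in nhds Chat, DifferentiableAt ℂ g x)
    (hgz : ∀ᶠ x in nhds Chat, J (Fin.snoc x (g x)) = 0)
    (φ : (Fin d → ℝ) → ℂ)
    (hφ : ContDiffAt ℝ 2 φ 0) (hφ0 : φ 0 = 0)
    (hφg : ∀ᶠ θ in nhds (0 : Fin d → ℝ), Complex.exp (φ θ) =
      g (fun i => C i.castSucc * Complex.exp (Complex.I * (θ i : ℂ))) / C (Fin.last d))
    (l : Fin d) :
    fderiv ℝ (fun θ => fderiv ℝ φ θ (Pi.single l 1)) 0 (Pi.single l 1) =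
      (C l.castSucc * pd l.castSucc) / (C (Fin.last d) * pd (Fin.last d)) +
        ((C l.castSucc) ^ 2 / ((C (Fin.last d)) ^ 2 * (pd (Fin.last d)) ^ 2)) *
          ((pd l.castSucc) ^ 2 + C (Fin.last d) *
            (pd (Fin.last d) * pd2 l.castSucc l.castSucc
              - 2 * pd l.castSucc * pd2 l.castSucc (Fin.last d)
              + ((pd l.castSucc) ^ 2 / pd (Fin.last d))
                  * pd2 (Fin.last d) (Fin.last d))) := by
  set e : Fin d → ℝ := Pi.single l 1 with he
  have hCd := hC (Fin.last d)
  have hline : Tendsto (fun t : ℝ => t • e) (𝓝 0) (𝓝 0) := by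
    have h : Continuous fun t : ℝ => t • e := by fun_prop
    simpa using h.tendsto 0
  have hφev : ∀ᶠ θ in 𝓝 0, DifferentiableAt ℝ φ θ :=
    (hφ.eventually (by simp)).mono fun θ h => h.differentiableAt (by norm_num)
  have hdφ : DifferentiableAt ℝ (fun θ => fderiv ℝ φ θ e) 0 :=
    ((hφ.fderiv_right (m := 1) (by norm_num [one_add_one_eq_two])).differentiableAt
      (by norm_num)).clm_apply (differentiableAt_const e)
  have ha : ∀ᶠ t : ℝ in 𝓝 0,
      HasDerivAt (fun s : ℝ => φ (s • e)) (fderiv ℝ φ (t • e) e) t :=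
    (hline.eventually hφev).mono fun t h => hasDerivAt_comp_smul h
  have hb : HasDerivAt (fun s : ℝ => fderiv ℝ φ (s • e) e)
      (fderiv ℝ (fun θ => fderiv ℝ φ θ e) 0 e) 0 := by
    have h := hasDerivAt_comp_smul (f := fun θ => fderiv ℝ φ θ e) (e := e) (t := 0)
      (by simpa using hdφ)
    simpa only [zero_smul] using h
  have hexp (t : ℝ) : HasDerivAt (fun s : ℝ => Complex.exp (Complex.I * (s : ℂ)))
      (Complex.exp (Complex.I * (t : ℂ)) * Complex.I) t := by
    have h := ((hasDerivAt_id t).ofReal_comp.const_mul Complex.I).cexp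
    simpa using h
  have hw : ∀ᶠ t : ℝ in 𝓝 0,
      HasDerivAt (fun s : ℝ => C (Fin.last d) * Complex.exp (φ (s • e)))
        (C (Fin.last d) * (Complex.exp (φ (t • e)) * fderiv ℝ φ (t • e) e)) t :=
    ha.mono fun t h => h.cexp.const_mul _
  have hw' := (ha.self_of_nhds.cexp.mul hb).const_mul (C (Fin.last d))
  have hu (t : ℝ) := (hexp t).const_mul (C l.castSucc)
  have hu' := ((hexp 0).mul_const Complex.I).const_mul (C l.castSucc)
  have hChat' : Tendsto
      (fun θ : Fin d → ℝ => fun i => C i.castSucc * Complex.exp (Complex.I * (θ i : ℂ)))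
      (𝓝 0) (𝓝 Chat) := by
    have h : Continuous (fun θ : Fin d → ℝ =>
        fun i => C i.castSucc * Complex.exp (Complex.I * (θ i : ℂ))) := by fun_prop
    have h0 := h.tendsto 0
    have hv : (fun i => C i.castSucc * Complex.exp (Complex.I * ((0 : Fin d → ℝ) i : ℂ)))
        = Chat := by
      ext i
      simp [hChat]
    rwa [hv] at h0
  have hz : ∀ᶠ t : ℝ in 𝓝 0, J (C
      + (C l.castSucc * Complex.exp (Complex.I * (t : ℂ))
          - C l.castSucc * Complex.exp (Complex.I * ((0 : ℝ) : ℂ)))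
        • (Pi.single l.castSucc 1 : Fin (d + 1) → ℂ)
      + (C (Fin.last d) * Complex.exp (φ (t • e))
          - C (Fin.last d) * Complex.exp (φ ((0 : ℝ) • e)))
        • (Pi.single (Fin.last d) 1 : Fin (d + 1) → ℂ)) = 0 := by
    filter_upwards [hline.eventually (hChat'.eventually hgz), hline.eventually hφg] with t h1 h2
    rw [← h1]
    congr 1
    ext i
    refine Fin.lastCases ?_ (fun j => ?_) i
    · rw [h2]
      simp [hφ0, (Fin.castSucc_lt_last l).ne']
      field_simp
    · rcases eq_or_ne j l with rfl | hj
      · simp [he, (Fin.castSucc_lt_last j).ne]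
      · simp [he, hj, (Fin.castSucc_lt_last j).ne]
  obtain ⟨h1, h2⟩ := second_deriv_of_vanishing_curve hJ (Eventually.of_forall hu) hu' hw hw' hz
  simp only [← hpd, ← hpd2, zero_smul, hφ0, Complex.ofReal_zero, mul_zero, Complex.exp_zero,
    one_mul] at h1 h2
  generalize fderiv ℝ (fun θ => fderiv ℝ φ θ e) 0 e = S at h2 ⊢
  generalize fderiv ℝ φ 0 e = b at h1 h2
  have hI := Complex.I_sq
  have hbv : b = -(Complex.I * C l.castSucc * pd l.castSucc)
      / (C (Fin.last d) * pd (Fin.last d)) := by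
    field_simp
    linear_combination h1
  have hS : S = -(-(C l.castSucc * pd l.castSucc) + C (Fin.last d) * b ^ 2 * pd (Fin.last d)
      - C l.castSucc ^ 2 * pd2 l.castSucc l.castSucc
      + 2 * Complex.I * C l.castSucc * C (Fin.last d) * b * pd2 l.castSucc (Fin.last d)
      + C (Fin.last d) ^ 2 * b ^ 2 * pd2 (Fin.last d) (Fin.last d))
      / (C (Fin.last d) * pd (Fin.last d)) := by
    field_simp
    linear_combination h2 - (C l.castSucc * pd l.castSucc
      + C l.castSucc ^ 2 * pd2 l.castSucc l.castSucc) * hI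
  have hb2 : b ^ 2 = -(C l.castSucc * pd l.castSucc) ^ 2
      / (C (Fin.last d) * pd (Fin.last d)) ^ 2 := by
    rw [hbv, div_pow]
    congr 1
    linear_combination (C l.castSucc * pd l.castSucc) ^ 2 * hI
  have hIb : Complex.I * b = C l.castSucc * pd l.castSucc
      / (C (Fin.last d) * pd (Fin.last d)) := by
    rw [hbv, ← mul_div_assoc]
    congr 1
    linear_combination -(C l.castSucc * pd l.castSucc) * hI
  rw [hS, show 2 * Complex.I * C l.castSucc * C (Fin.last d) * b * pd2 l.castSucc (Fin.last d)
    = 2 * C l.castSucc * C (Fin.last d) * (Complex.I * b) * pd2 l.castSucc (Fin.last d) by ring,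
    hIb, hb2]
  field_simp
  ring
end

section
/- Let J(x,y) = 1 − x − y + xy − x²y² on ℂ². The set of points (x,y) ∈ ℂ² satisfying J(x,y) = 0 and x·J_x(x,y) = y·J_y(x,y) (where J_x = −1 + y − 2xy² and J_y = −1 + x − 2x²y) is exactly { (t,t) : t ∈ { (√5 − 1)/2, −(1 + √5)/2, (1 + i√3)/2, (1 − i√3)/2 } }. -/
/-- The critical points of 1/(1 − x − y + xy − x²y²) for the main diagonal are
exactly the four diagonal points (t,t) with
t ∈ {(√5 − 1)/2, −(1 + √5)/2, (1 ± i√3)/2}. -/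
theorem stmt5 :
    {p : ℂ × ℂ | (1 - p.1 - p.2 + p.1 * p.2 - p.1 ^ 2 * p.2 ^ 2 = 0) ∧
        p.1 * (-1 + p.2 - 2 * p.1 * p.2 ^ 2) = p.2 * (-1 + p.1 - 2 * p.1 ^ 2 * p.2)} =
      {p : ℂ × ℂ | ∃ t ∈ ({((Real.sqrt 5 : ℂ) - 1) / 2, -((1 + (Real.sqrt 5 : ℂ)) / 2),
          (1 + Complex.I * (Real.sqrt 3 : ℂ)) / 2,
          (1 - Complex.I * (Real.sqrt 3 : ℂ)) / 2} : Set ℂ), p = (t, t)} := by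
  have h5 : (Real.sqrt 5 : ℂ) ^ 2 = 5 := by
    exact_mod_cast Real.sq_sqrt (show (0 : ℝ) ≤ 5 by norm_num)
  have h3 : (Real.sqrt 3 : ℂ) ^ 2 = 3 := by
    exact_mod_cast Real.sq_sqrt (show (0 : ℝ) ≤ 3 by norm_num)
  have hI := Complex.I_sq
  ext ⟨x, y⟩
  simp only [Set.mem_ofPred_eq, Set.mem_insert_iff, Set.mem_singleton_iff, Prod.mk.injEq]
  generalize (Real.sqrt 5 : ℂ) = a at *
  generalize (Real.sqrt 3 : ℂ) = b at *
  generalize Complex.I = i at *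
  have factor : ∀ t : ℂ, 1 - t - t + t * t - t ^ 2 * t ^ 2 =
      -((t - (a - 1) / 2) * ((t - -((1 + a) / 2)) *
        ((t - (1 + i * b) / 2) * (t - (1 - i * b) / 2)))) := by
    intro t
    have golden : (t - (a - 1) / 2) * (t - -((1 + a) / 2)) = t ^ 2 + t - 1 := by
      linear_combination (-1 / 4) * h5
    have cyclotomic : (t - (1 + i * b) / 2) * (t - (1 - i * b) / 2) = t ^ 2 - t + 1 := by
      linear_combination (-b ^ 2 / 4) * hI + (1 / 4) * h3
    rw [← mul_assoc (t - (a - 1) / 2), golden, cyclotomic]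
    ring
  constructor
  · rintro ⟨hJ, hcrit⟩
    obtain rfl : x = y := by linear_combination -hcrit
    refine ⟨x, ?_, rfl, rfl⟩
    simpa only [factor, neg_eq_zero, mul_eq_zero, sub_eq_zero] using hJ
  · rintro ⟨t, ht, rfl, rfl⟩
    refine ⟨?_, by ring⟩
    simpa only [factor, neg_eq_zero, mul_eq_zero, sub_eq_zero] using ht
end

section
/- For n ≥ 1, let f_n be the number of binary words of length 2n over the alphabet {0,1} that contain exactly n zeros and n ones and contain no occurrence of 010 or 101 as a factor (three consecutive letters). Then f_n · ω^n · √(√5 π n)/2 → 1 as n → ∞, where ω = (3 − √5)/2. Equivalently, f_n ∼ (2/(3 − √5))^n · 2/√(√5 π n). -/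
namespace ZigzagFree

open PowerSeries Filter Topology

/-- The power series of `(1 - X) ^ (-1/2)`. -/
noncomputable def centralSeries : PowerSeries ℝ :=
  PowerSeries.mk fun n => (Nat.centralBinom n : ℝ) / 4 ^ n

lemma coeff_centralSeries_succ (n : ℕ) :
    (n + 1 : ℝ) * 2 * coeff (n + 1) centralSeries = (2 * n + 1) * coeff n centralSeries := by
  have h : ((n : ℝ) + 1) * (Nat.centralBinom (n + 1) : ℝ)
      = 2 * (2 * n + 1) * (Nat.centralBinom n : ℝ) := by
    exact_mod_cast Nat.succ_mul_centralBinom_succ n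
  simp only [centralSeries, coeff_mk, pow_succ]
  field_simp
  linear_combination 2 * h

lemma constantCoeff_centralSeries : constantCoeff centralSeries = 1 := by
  rw [← coeff_zero_eq_constantCoeff_apply]
  simp [centralSeries]

lemma coeff_centralSeries_pos (n : ℕ) : 0 < coeff n centralSeries := by
  simp only [centralSeries, coeff_mk]
  have := Nat.centralBinom_pos n
  positivity

lemma sq_coeff_centralSeries_le (n : ℕ) : (coeff n centralSeries) ^ 2 * (n + 1) ≤ 1 := by
  induction n with
  | zero => simp [constantCoeff_centralSeries]
  | succ n ih =>
    have h := coeff_centralSeries_succ n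
    set b := coeff n centralSeries
    have h' : coeff (n + 1) centralSeries = (2 * n + 1) * b / (2 * (n + 1)) := by
      field_simp
      linear_combination h
    rw [h']
    refine le_trans ?_ ih
    push_cast
    rw [div_pow, div_mul_eq_mul_div, div_le_iff₀ (by positivity)]
    have : 0 ≤ b ^ 2 * (3 * (n : ℝ) + 2) := by positivity
    nlinarith

lemma coeff_centralSeries_le_one (n : ℕ) : coeff n centralSeries ≤ 1 := by
  have h := sq_coeff_centralSeries_le n
  have h0 := coeff_centralSeries_pos n
  have : 0 ≤ coeff n centralSeries ^ 2 * (n : ℝ) := by positivity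
  nlinarith

lemma sq_coeff_centralSeries_mul_wallis (n : ℕ) :
    (coeff n centralSeries) ^ 2 * ((2 * n + 1) * Real.Wallis.W n) = 1 := by
  induction n with
  | zero => simp [constantCoeff_centralSeries, Real.Wallis.W]
  | succ n ih =>
    have h := coeff_centralSeries_succ n
    have h' : coeff (n + 1) centralSeries
        = (2 * n + 1) * coeff n centralSeries / (2 * (n + 1)) := by
      field_simp
      linear_combination h
    have e : ∀ b W : ℝ, ((2 * n + 1) * b / (2 * (n + 1))) ^ 2 *
        ((2 * ((n + 1 : ℕ) : ℝ) + 1) *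
          (W * ((2 * n + 2) / (2 * n + 1) * ((2 * n + 2) / (2 * n + 3)))))
        = b ^ 2 * ((2 * n + 1) * W) := by
      intro b W
      push_cast
      rw [show 2 * ((n : ℝ) + 1) + 1 = 2 * n + 3 by ring]
      field_simp
    rw [h', Real.Wallis.W_succ, e, ih]

lemma tendsto_coeff_centralSeries :
    Tendsto (fun n : ℕ => coeff n centralSeries * √n) atTop (𝓝 (1 / √Real.pi)) := by
  have h : ∀ n : ℕ, coeff n centralSeries * √n
      = √(((n : ℝ) / (2 * n + 1)) / Real.Wallis.W n) := by
    intro n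
    have hW := Real.Wallis.W_pos n
    have := sq_coeff_centralSeries_mul_wallis n
    rw [← Real.sqrt_sq (coeff_centralSeries_pos n).le, ← Real.sqrt_mul (sq_nonneg _)]
    congr 1
    field_simp
    linear_combination (n : ℝ) * this
  simp_rw [h]
  have h1 := Stirling.tendsto_self_div_two_mul_self_add_one.div
    Real.Wallis.tendsto_W_nhds_pi_div_two (by positivity)
  have h2 := (Real.continuous_sqrt.tendsto _).comp h1
  rwa [show (1 / 2 : ℝ) / (Real.pi / 2) = 1 / Real.pi by field_simp,
    Real.sqrt_div zero_le_one, Real.sqrt_one] at h2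

lemma centralSeries_sq : centralSeries ^ 2 * (1 - X) = 1 := by
  have hd : 2 * derivative ℝ centralSeries * (1 - X) = centralSeries := by
    ext n
    rw [mul_sub, mul_one, map_sub, mul_assoc]
    have h2 (p : PowerSeries ℝ) (k : ℕ) : coeff k (2 * p) = 2 * coeff k p := by
      rw [← coeff_C_mul]; rfl
    rw [h2, h2]
    have h := coeff_centralSeries_succ n
    cases n with
    | zero =>
      simp only [coeff_zero_mul_X, coeff_derivative]
      linear_combination h
    | succ n =>
      rw [coeff_succ_mul_X]
      simp only [coeff_derivative]
      push_cast at h ⊢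
      linear_combination h
  apply derivative.ext
  · have h1 : derivative ℝ (1 - X : PowerSeries ℝ) = -1 := by simp
    rw [Derivation.leibniz, Derivation.leibniz_pow, h1]
    simp only [smul_eq_mul, Nat.add_one_sub_one, pow_one, nsmul_eq_mul, Nat.cast_ofNat,
      Derivation.map_one_eq_zero]
    linear_combination centralSeries * hd
  · simp [constantCoeff_centralSeries]

/-- Absolute convergence of a power series at `r`. -/
def AbsConv (r : ℝ) (p : PowerSeries ℝ) : Prop :=
  Summable fun n => ‖coeff n p * r ^ n‖

/-- The value of a power series at `r`. -/
noncomputable def value (r : ℝ) (p : PowerSeries ℝ) : ℝ :=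
  ∑' n, coeff n p * r ^ n

lemma coeff_mul_mul_pow (r : ℝ) (p q : PowerSeries ℝ) (n : ℕ) :
    coeff n (p * q) * r ^ n = ∑ kl ∈ Finset.HasAntidiagonal.antidiagonal n,
      (coeff kl.1 p * r ^ kl.1) * (coeff kl.2 q * r ^ kl.2) := by
  rw [coeff_mul, Finset.sum_mul]
  refine Finset.sum_congr rfl fun kl hkl => ?_
  rw [← Finset.HasAntidiagonal.mem_antidiagonal.mp hkl, pow_add]
  ring

lemma AbsConv.mul {r : ℝ} {p q : PowerSeries ℝ} (hp : AbsConv r p) (hq : AbsConv r q) :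
    AbsConv r (p * q) := by
  unfold AbsConv
  simp_rw [coeff_mul_mul_pow]
  unfold AbsConv at hp hq
  exact summable_norm_sum_mul_antidiagonal_of_summable_norm
    (f := fun n => coeff n p * r ^ n) (g := fun n => coeff n q * r ^ n) hp hq

lemma value_mul {r : ℝ} {p q : PowerSeries ℝ} (hp : AbsConv r p) (hq : AbsConv r q) :
    value r (p * q) = value r p * value r q := by
  unfold AbsConv at hp hq
  rw [value, value, value, tsum_congr (coeff_mul_mul_pow r p q)]
  exact (tsum_mul_tsum_eq_tsum_sum_antidiagonal_of_summable_norm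
    (f := fun n => coeff n p * r ^ n) (g := fun n => coeff n q * r ^ n) hp hq).symm

lemma value_add {r : ℝ} {p q : PowerSeries ℝ} (hp : AbsConv r p) (hq : AbsConv r q) :
    value r (p + q) = value r p + value r q := by
  unfold value
  simp_rw [map_add, add_mul]
  exact Summable.tsum_add hp.of_norm hq.of_norm

lemma AbsConv.add {r : ℝ} {p q : PowerSeries ℝ} (hp : AbsConv r p) (hq : AbsConv r q) :
    AbsConv r (p + q) := by
  refine Summable.of_nonneg_of_le (fun _ => norm_nonneg _) (fun n => ?_) (Summable.add hp hq)
  rw [map_add, add_mul]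
  exact norm_add_le _ _

lemma absConv_monomial (r a : ℝ) (k : ℕ) : AbsConv r (monomial k a) := by
  refine summable_of_ne_finset_zero (s := {k}) fun n hn => ?_
  rw [coeff_monomial, if_neg (by simpa using hn)]
  simp

lemma value_monomial (r a : ℝ) (k : ℕ) : value r (monomial k a) = a * r ^ k := by
  unfold value
  rw [tsum_eq_single k]
  · simp
  · intro n hn
    rw [coeff_monomial, if_neg hn, zero_mul]

lemma absConv_of_abs_coeff_le_one {r : ℝ} (h0 : 0 ≤ r) (h1 : r < 1) {p : PowerSeries ℝ}
    (hp : ∀ n, |coeff n p| ≤ 1) : AbsConv r p := by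
  refine Summable.of_nonneg_of_le (fun _ => norm_nonneg _) (fun n => ?_)
    (summable_geometric_of_lt_one h0 h1)
  rw [norm_mul, Real.norm_eq_abs, norm_pow, Real.norm_of_nonneg h0]
  exact mul_le_of_le_one_left (by positivity) (hp n)

lemma value_pos {r : ℝ} (h0 : 0 ≤ r) {p : PowerSeries ℝ} (hp : AbsConv r p)
    (hn : ∀ n, 0 ≤ coeff n p) (hc : 0 < constantCoeff p) : 0 < value r p := by
  refine hp.of_norm.tsum_pos (fun n => mul_nonneg (hn n) (by positivity)) 0 ?_
  simpa using hc

/-- If `p` converges absolutely slightly beyond `ω`, then the coefficients of the product of `p`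
with the expansion of `(1 - X / ω) ^ (-1/2)` follow those of the latter. -/
lemma tendsto_coeff_mul_rescale {ω : ℝ} (h0 : 0 < ω) {p : PowerSeries ℝ}
    (hp : AbsConv (3 / 2 * ω) p) :
    Tendsto (fun n : ℕ => coeff n (p * rescale ω⁻¹ centralSeries) * ω ^ n * √n) atTop
      (𝓝 (value ω p * (1 / √Real.pi))) := by
  have key : ∀ n : ℕ, coeff n (p * rescale ω⁻¹ centralSeries) * ω ^ n * √n
      = ∑' k, if k ≤ n then coeff k p * ω ^ k * (coeff (n - k) centralSeries * √n) else 0 := by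
    intro n
    rw [tsum_eq_sum (s := Finset.range (n + 1))]
    · rw [coeff_mul, Finset.Nat.sum_antidiagonal_eq_sum_range_succ_mk, Finset.sum_mul,
        Finset.sum_mul]
      refine Finset.sum_congr rfl fun k hk => ?_
      have hk' : k ≤ n := Nat.lt_succ_iff.mp (Finset.mem_range.mp hk)
      rw [if_pos hk', coeff_rescale]
      obtain ⟨m, rfl⟩ := Nat.exists_eq_add_of_le hk'
      simp only [Nat.add_sub_cancel_left]
      rw [pow_add, inv_pow]
      field_simp
    · intro k hk
      rw [if_neg (by simpa [Nat.lt_succ_iff] using hk)]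
  simp_rw [key, value]
  rw [← tsum_mul_right]
  refine tendsto_tsum_of_dominated_convergence
    (bound := fun k => 2 * ‖coeff k p * (3 / 2 * ω) ^ k‖) (Summable.mul_left _ hp) ?_ ?_
  · intro k
    have h1 : Tendsto (fun n : ℕ => coeff (n - k) centralSeries * √n) atTop
        (𝓝 (1 / √Real.pi)) := by
      rw [← tendsto_add_atTop_iff_nat k]
      simp only [Nat.add_sub_cancel]
      have hr : Tendsto (fun n : ℕ => √(((n + k : ℕ) : ℝ) / n)) atTop (𝓝 1) := by
        have : Tendsto (fun n : ℕ => (((n + k : ℕ) : ℝ) / n)) atTop (𝓝 1) := by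
          have := (tendsto_const_div_atTop_nhds_zero_nat (k : ℝ)).const_add 1
          rw [add_zero] at this
          refine this.congr' ?_
          filter_upwards [eventually_gt_atTop 0] with n hn
          push_cast
          field_simp
        have h := (Real.continuous_sqrt.tendsto _).comp this
        rw [Real.sqrt_one] at h
        exact h
      have := tendsto_coeff_centralSeries.mul hr
      rw [mul_one] at this
      refine this.congr' ?_
      filter_upwards [eventually_gt_atTop 0] with n hn
      rw [mul_assoc, ← Real.sqrt_mul (by positivity)]
      congr 2
      field_simp
    refine (h1.const_mul (coeff k p * ω ^ k)).congr' ?_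
    filter_upwards [eventually_ge_atTop k] with n hn
    rw [if_pos hn]
  · refine Eventually.of_forall fun n k => ?_
    split_ifs with hk
    · have hb : coeff (n - k) centralSeries * √n ≤ k + 1 := by
        obtain ⟨m, rfl⟩ := Nat.exists_eq_add_of_le hk
        rw [Nat.add_sub_cancel_left]
        refine abs_le_of_sq_le_sq' ?_ (by positivity) |>.2
        rw [mul_pow, Real.sq_sqrt (by positivity)]
        have h1 := sq_coeff_centralSeries_le m
        have h2 : coeff m centralSeries ^ 2 * ((k + m : ℕ) : ℝ)
            ≤ coeff m centralSeries ^ 2 * ((m + 1) * (k + 1)) := by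
          refine mul_le_mul_of_nonneg_left ?_ (by positivity)
          push_cast
          nlinarith [mul_nonneg (Nat.cast_nonneg (α := ℝ) m) (Nat.cast_nonneg (α := ℝ) k)]
        have h3 : coeff m centralSeries ^ 2 * ((m + 1) * (k + 1)) ≤ 1 * ((k : ℝ) + 1) := by
          rw [← mul_assoc]
          exact mul_le_mul_of_nonneg_right h1 (by positivity)
        nlinarith [Nat.cast_nonneg (α := ℝ) k]
      have hc : (k : ℝ) + 1 ≤ 2 * (3 / 2) ^ k := by
        have := one_add_mul_le_pow (a := (1 / 2 : ℝ)) (by norm_num) k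
        norm_num at this
        linarith
      have h0' : 0 ≤ coeff (n - k) centralSeries * √n :=
        mul_nonneg (coeff_centralSeries_pos _).le (Real.sqrt_nonneg _)
      have h32 : (0 : ℝ) ≤ (3 / 2) ^ k := by positivity
      rw [norm_mul, Real.norm_of_nonneg h0', mul_pow, norm_mul, norm_mul, norm_mul,
        Real.norm_of_nonneg (pow_nonneg h0.le k), Real.norm_of_nonneg h32]
      have := mul_le_mul_of_nonneg_left (hb.trans hc)
        (show 0 ≤ ‖coeff k p‖ * ω ^ k by positivity)
      linarith
    · rw [norm_zero]
      positivity

/-- A list with no three consecutive letters of the form `a, b, a` with `a ≠ b`. -/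
def IsZigzagFree : List (Fin 2) → Prop
  | a :: b :: c :: l => ¬(a = c ∧ a ≠ b) ∧ IsZigzagFree (b :: c :: l)
  | _ => True

lemma isZigzagFree_ofFn {m : ℕ} (w : Fin m → Fin 2) :
    IsZigzagFree (List.ofFn w) ↔ ∀ i : ℕ, ∀ h : i + 2 < m,
      ¬((w ⟨i, by omega⟩ = 0 ∧ w ⟨i + 1, by omega⟩ = 1 ∧ w ⟨i + 2, by omega⟩ = 0) ∨
        (w ⟨i, by omega⟩ = 1 ∧ w ⟨i + 1, by omega⟩ = 0 ∧ w ⟨i + 2, by omega⟩ = 1)) := by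
  induction m with
  | zero => simp [IsZigzagFree]
  | succ m ih =>
    match m, w, ih with
    | 0, w, _ => simp [IsZigzagFree]
    | 1, w, _ => simp [IsZigzagFree]
    | m + 2, w, ih =>
      have ih := ih (fun i => w i.succ)
      rw [List.ofFn_succ] at ih
      rw [List.ofFn_succ, List.ofFn_succ, List.ofFn_succ, IsZigzagFree,
        ← List.ofFn_succ (f := fun i : Fin (m + 1) => w i.succ.succ), ih]
      have key : ∀ a b c : Fin 2, ¬(a = c ∧ a ≠ b) ↔
          ¬((a = 0 ∧ b = 1 ∧ c = 0) ∨ (a = 1 ∧ b = 0 ∧ c = 1)) := by decide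
      rw [key]
      constructor
      · rintro ⟨h0, h⟩ i hi
        cases i with
        | zero => exact h0
        | succ i => exact h i (by omega)
      · intro h
        exact ⟨h 0 (by omega), fun i hi => h (i + 1) (by omega)⟩

lemma count_ofFn {m : ℕ} (w : Fin m → Fin 2) (a : Fin 2) :
    (List.ofFn w).count a = (Finset.univ.filter fun i => w i = a).card := by
  induction m with
  | zero => simp
  | succ m ih =>
    rw [List.ofFn_succ, List.count_cons, ih, Fin.univ_succ, Finset.filter_cons]
    split_ifs with h h' h'
    · simp [Finset.filter_map]
    · simp_all
    · simp_all
    · simp [Finset.filter_map]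

/-- The number of words of length `m` satisfying `P`. -/
noncomputable def wordCount (m : ℕ) (P : List (Fin 2) → Prop) : ℕ :=
  Nat.card {w : Fin m → Fin 2 // P (List.ofFn w)}

lemma wordCount_congr {m : ℕ} {P Q : List (Fin 2) → Prop} (h : ∀ l, P l ↔ Q l) :
    wordCount m P = wordCount m Q := by
  rw [show P = Q from funext fun l => propext (h l)]

lemma wordCount_false (m : ℕ) {P : List (Fin 2) → Prop} (h : ∀ l, ¬ P l) :
    wordCount m P = 0 := by
  have : IsEmpty {w : Fin m → Fin 2 // P (List.ofFn w)} := ⟨fun w => h _ w.2⟩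
  exact Nat.card_of_isEmpty

lemma wordCount_zero {P : List (Fin 2) → Prop} (h : P []) : wordCount 0 P = 1 := by
  have : Unique {w : Fin 0 → Fin 2 // P (List.ofFn w)} :=
    { default := ⟨Fin.elim0, by simpa using h⟩
      uniq := fun w => Subtype.ext (Subsingleton.elim _ _) }
  exact Nat.card_unique

lemma wordCount_succ (m : ℕ) (P : List (Fin 2) → Prop) :
    wordCount (m + 1) P = wordCount m (fun l => P (0 :: l)) + wordCount m (fun l => P (1 :: l)) := by
  let Q : Fin 2 → (Fin m → Fin 2) → Prop := fun a w => P (a :: List.ofFn w)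
  have e : {w : Fin (m + 1) → Fin 2 // P (List.ofFn w)} ≃
      {x : Fin 2 × (Fin m → Fin 2) // Q x.1 x.2} :=
    ((Fin.consEquiv fun _ => Fin 2).subtypeEquiv fun x => by
      simp [Q, List.ofFn_succ]).symm
  have e2 : {x : Fin 2 × (Fin m → Fin 2) // Q x.1 x.2} ≃ Σ a : Fin 2, {w // Q a w} :=
    { toFun := fun x => ⟨x.1.1, x.1.2, x.2⟩
      invFun := fun x => ⟨(x.1, x.2.1), x.2.2⟩
      left_inv := fun _ => rfl
      right_inv := fun _ => rfl }
  unfold wordCount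
  rw [Nat.card_congr (e.trans e2), Nat.card_sigma, Fin.sum_univ_two]

/-- The number of words with `i` zeros and `j` ones that, appended to `p`, give a
zigzag-free word. -/
noncomputable def extCount (p : List (Fin 2)) (i j : ℕ) : ℕ :=
  wordCount (i + j) fun l => l.count 0 = i ∧ l.count 1 = j ∧ IsZigzagFree (p ++ l)

lemma extCount_congr {p q : List (Fin 2)}
    (h : ∀ l, IsZigzagFree (p ++ l) ↔ IsZigzagFree (q ++ l)) (i j : ℕ) :
    extCount p i j = extCount q i j :=
  wordCount_congr fun l => by rw [h]

lemma extCount_zero_zero {p : List (Fin 2)} (hp : IsZigzagFree p) : extCount p 0 0 = 1 :=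
  wordCount_zero (by simpa using hp)

lemma extCount_eq_zero {p : List (Fin 2)} (h : ∀ l, ¬ IsZigzagFree (p ++ l)) (i j : ℕ) :
    extCount p i j = 0 :=
  wordCount_false _ fun l hl => h l hl.2.2

lemma extCount_succ_zero (p : List (Fin 2)) (i : ℕ) :
    extCount p (i + 1) 0 = extCount (p ++ [0]) i 0 := by
  refine (wordCount_succ (i + 0) _).trans ((congrArg₂ (· + ·) (wordCount_congr fun l => ?_)
    (wordCount_false _ fun l hl => ?_)).trans (add_zero _))
  · simp
  · simp at hl

lemma extCount_zero_succ (p : List (Fin 2)) (j : ℕ) :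
    extCount p 0 (j + 1) = extCount (p ++ [1]) 0 j := by
  refine (wordCount_succ (0 + j) _).trans ((congrArg₂ (· + ·) (wordCount_false _ fun l hl => ?_)
    (wordCount_congr fun l => ?_)).trans (zero_add _))
  · simp at hl
  · simp

lemma extCount_succ_succ (p : List (Fin 2)) (i j : ℕ) :
    extCount p (i + 1) (j + 1)
      = extCount (p ++ [0]) i (j + 1) + extCount (p ++ [1]) (i + 1) j := by
  unfold extCount
  rw [show i + 1 + (j + 1) = i + (j + 1) + 1 by ring, wordCount_succ,
    show i + 1 + j = i + (j + 1) by ring]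
  congr 1
  · exact wordCount_congr fun l => by simp
  · exact wordCount_congr fun l => by simp

lemma isZigzagFree_cons_cons_self (a : Fin 2) (l : List (Fin 2)) :
    IsZigzagFree (a :: a :: l) ↔ IsZigzagFree (a :: l) := by
  cases l <;> simp [IsZigzagFree]

lemma isZigzagFree_triple {a b : Fin 2} (h : a ≠ b) (l : List (Fin 2)) :
    IsZigzagFree (a :: b :: b :: l) ↔ IsZigzagFree (b :: l) := by
  rw [IsZigzagFree, isZigzagFree_cons_cons_self]
  simp [h]

lemma extCount_nil_succ_succ (i j : ℕ) :
    extCount [] (i + 1) (j + 1) = extCount [0] i (j + 1) + extCount [1] (i + 1) j :=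
  extCount_succ_succ [] i j

lemma extCount_cons_self (a : Fin 2) (i j : ℕ) : extCount [a, a] i j = extCount [a] i j :=
  extCount_congr (isZigzagFree_cons_cons_self a) i j

lemma extCount_triple {a b : Fin 2} (h : a ≠ b) (i j : ℕ) :
    extCount [a, b, b] i j = extCount [b] i j :=
  extCount_congr (isZigzagFree_triple h) i j

lemma extCount_zigzag {a b : Fin 2} (h : a ≠ b) (i j : ℕ) : extCount [a, b, a] i j = 0 := by
  refine extCount_eq_zero (fun l hl => ?_) i j
  change IsZigzagFree (a :: b :: a :: l) at hl
  rw [IsZigzagFree] at hl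
  exact hl.1 ⟨rfl, h⟩

/-- The recursion characterising the words that extend a run of zeros; the words that extend a
run of ones satisfy it with the arguments exchanged. -/
structure IsExtRec (g : ℕ → ℕ → ℝ) : Prop where
  zero_zero : g 0 0 = 1
  zero_one : g 0 1 = 1
  succ_zero : ∀ i, g (i + 1) 0 = g i 0
  zero_add_two : ∀ j, g 0 (j + 2) = g j 0
  succ_one : ∀ i, g (i + 1) 1 = g i 1
  succ_add_two : ∀ i j, g (i + 1) (j + 2) = g i (j + 2) + g j (i + 1)

lemma IsExtRec.extCount_eq {g : ℕ → ℕ → ℝ} (hg : IsExtRec g) (m : ℕ) :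
    ∀ i j, i + j = m → (extCount [0] i j : ℝ) = g i j ∧ (extCount [1] j i : ℝ) = g i j := by
  have h01 : (0 : Fin 2) ≠ 1 := by decide
  have h10 : (1 : Fin 2) ≠ 0 := by decide
  induction m using Nat.strong_induction_on with
  | _ m ih =>
    intro i j hij
    match i, j with
    | 0, 0 => 
      rw [extCount_zero_zero (by simp [IsZigzagFree]), extCount_zero_zero (by simp [IsZigzagFree])]
      simp [hg.zero_zero]
    | 0, 1 =>
      rw [extCount_zero_succ, extCount_succ_zero,
        extCount_zero_zero (by simp [IsZigzagFree]), extCount_zero_zero (by simp [IsZigzagFree])]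
      simp [hg.zero_one]
    | i + 1, 0 =>
      rw [extCount_zero_succ, extCount_succ_zero]
      simp only [List.cons_append, List.nil_append, extCount_cons_self, hg.succ_zero]
      exact ih i (by omega) i 0 (by omega)
    | 0, j + 2 =>
      rw [extCount_zero_succ, extCount_succ_zero, extCount_zero_succ, extCount_succ_zero]
      simp only [List.cons_append, List.nil_append, extCount_triple h01, extCount_triple h10,
        hg.zero_add_two]
      exact (ih j (by omega) j 0 (by omega)).symm
    | i + 1, 1 =>
      have h := ih (i + 1) (by omega) i 1 (by omega)
      rw [extCount_succ_succ, extCount_succ_succ, extCount_succ_zero, extCount_zero_succ]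
      simp only [List.cons_append, List.nil_append, extCount_cons_self, extCount_zigzag h01,
        extCount_zigzag h10, hg.succ_one, zero_add, add_zero]
      exact h
    | i + 1, j + 2 =>
      have h := ih (i + (j + 2)) (by omega) i (j + 2) rfl
      have h' := ih (j + (i + 1)) (by omega) j (i + 1) rfl
      rw [extCount_succ_succ, extCount_succ_succ [1], extCount_succ_succ ([0] ++ [1]),
        extCount_succ_succ ([1] ++ [0])]
      simp only [List.cons_append, List.nil_append, extCount_cons_self, extCount_zigzag h01,
        extCount_zigzag h10, extCount_triple h01, extCount_triple h10, hg.succ_add_two,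
        zero_add, add_zero]
      push_cast
      exact ⟨by rw [h.1, h'.2], by rw [h.2, h'.1]; ring⟩

/-- The coefficients, read along diagonals, of the bivariate generating function of the words
extending a run of zeros. -/
noncomputable def diagCoeff (S L : PowerSeries ℝ) (i j : ℕ) : ℝ :=
  if j ≤ i then coeff j (S * L ^ (i - j) * (1 + X ^ 2 * L))
  else coeff i (S * L ^ (j - i - 1) * (L + X))

section Diagonal

variable {S L : PowerSeries ℝ}

lemma diagCoeff_add_left (S L : PowerSeries ℝ) (n d : ℕ) :
    diagCoeff S L (n + d) n = coeff n (S * L ^ d * (1 + X ^ 2 * L)) := by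
  rw [diagCoeff, if_pos (by omega), Nat.add_sub_cancel_left]

lemma diagCoeff_add_right (S L : PowerSeries ℝ) (n d : ℕ) :
    diagCoeff S L n (n + d + 1) = coeff n (S * L ^ d * (L + X)) := by
  rw [diagCoeff, if_neg (by omega), show n + d + 1 - n - 1 = d by omega]

lemma coeff_add_two_X_sq_mul (n : ℕ) (p : PowerSeries ℝ) :
    coeff (n + 2) (X ^ 2 * p) = coeff n p :=
  coeff_X_pow_mul p 2 n

lemma constantCoeff_of_quadratic (hL : (1 + X - X ^ 2) * L = 1 + X * L ^ 2) :
    constantCoeff L = 1 := by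
  simpa using congrArg constantCoeff hL

lemma isExtRec_diagCoeff (hS : constantCoeff S = 1)
    (hL : (1 + X - X ^ 2) * L = 1 + X * L ^ 2)
    (hSL : S * (1 + X - X ^ 2 - 2 * (X * L)) = 1) : IsExtRec (diagCoeff S L) := by
  have hL0 := constantCoeff_of_quadratic hL
  have hleft (d : ℕ) : coeff 0 (S * L ^ d * (1 + X ^ 2 * L)) = 1 := by
    simp [hS, hL0]
  have hright (d : ℕ) : coeff 0 (S * L ^ d * (L + X)) = 1 := by
    simp [hS, hL0]
  have hrow0 (i : ℕ) : diagCoeff S L i 0 = 1 := by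
    have := diagCoeff_add_left S L 0 i
    rwa [zero_add, hleft] at this
  have hcol0 (j : ℕ) : diagCoeff S L 0 (j + 1) = 1 := by
    have := diagCoeff_add_right S L 0 j
    rwa [zero_add, hright] at this
  have hA (d : ℕ) : S * L ^ (d + 1) * (1 + X ^ 2 * L)
      = S * L ^ d * (1 + X ^ 2 * L) + X ^ 2 * (S * L ^ (d + 2) * (L + X)) := by
    linear_combination S * L ^ d * (1 + X * L) * hL
  have hB : S * L ^ 0 * (1 + X ^ 2 * L)
      = 1 + X * (S * L ^ 0 * (L + X)) + X ^ 2 * (S * L ^ 1 * (L + X)) := by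
    linear_combination S * X * hL + hSL
  have hC (d : ℕ) : S * L ^ (d + 1) * (L + X)
      = X * (S * L ^ (d + 2) * (L + X)) + S * L ^ d * (1 + X ^ 2 * L) := by
    linear_combination S * L ^ d * (1 + L) * hL
  have hD : S * L ^ 0 * (L + X)
      = X * (S * L ^ 1 * (L + X)) + X * (S * L ^ 0 * (L + X)) + 1 := by
    linear_combination S * hL + hSL
  have hX2 (p : PowerSeries ℝ) : coeff 1 (X ^ 2 * p) = 0 := by
    rw [coeff_X_pow_mul', if_neg (by norm_num)]
  refine ⟨hrow0 0, hcol0 0, fun i => by rw [hrow0, hrow0], fun j => by rw [hrow0, hcol0],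
    fun i => ?_, fun i j => ?_⟩
  · cases i with
    | zero =>
      have h := congrArg (coeff 1) hB
      rw [map_add, map_add, hX2, coeff_succ_X_mul 0, ← diagCoeff_add_right,
        ← diagCoeff_add_left] at h
      simpa [coeff_one] using h
    | succ i =>
      have h := congrArg (coeff 1) (hA i)
      rw [map_add, hX2, ← diagCoeff_add_left, ← diagCoeff_add_left, add_zero] at h
      rwa [show 1 + (i + 1) = i + 1 + 1 by ring, add_comm 1 i] at h
  · rcases lt_trichotomy i (j + 1) with hij | rfl | hij
    · obtain ⟨e, rfl⟩ := Nat.exists_eq_add_of_le (Nat.lt_succ_iff.mp hij)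
      cases e with
      | zero =>
        have h := congrArg (coeff (i + 1)) hD
        rw [map_add, map_add, coeff_succ_X_mul, coeff_succ_X_mul, ← diagCoeff_add_right,
          ← diagCoeff_add_right, ← diagCoeff_add_right] at h
        simpa [coeff_one] using h
      | succ e =>
        have h := congrArg (coeff (i + 1)) (hC e)
        rw [map_add, coeff_succ_X_mul, ← diagCoeff_add_right, ← diagCoeff_add_right,
          ← diagCoeff_add_left] at h
        convert h using 2 <;> ring_nf
    · have h := congrArg (coeff (j + 2)) hB
      rw [map_add, map_add, coeff_succ_X_mul, coeff_add_two_X_sq_mul, ← diagCoeff_add_right,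
        ← diagCoeff_add_right, ← diagCoeff_add_left] at h
      simpa [coeff_one] using h
    · obtain ⟨d, rfl⟩ := Nat.exists_eq_add_of_lt hij
      have h := congrArg (coeff (j + 2)) (hA d)
      rw [map_add, coeff_add_two_X_sq_mul, ← diagCoeff_add_right, ← diagCoeff_add_left,
        ← diagCoeff_add_left] at h
      convert h using 2 <;> ring_nf

/-- The generating function of the numbers of balanced words. -/
lemma two_mul_diagCoeff (hSL : S * (1 + X - X ^ 2 - 2 * (X * L)) = 1) (n : ℕ) :
    2 * diagCoeff S L n (n + 1) = coeff (n + 1) ((1 + X + X ^ 2) * S) := by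
  have h : (1 + X + X ^ 2) * S = 1 + X * (S * L ^ 0 * (L + X) + S * L ^ 0 * (L + X)) := by
    linear_combination hSL
  rw [h, map_add, coeff_succ_X_mul, map_add, ← diagCoeff_add_right]
  simp [coeff_one, two_mul]

lemma exists_diagonal_root (hS : constantCoeff S = 1)
    (hS2 : S ^ 2 * ((1 + X - X ^ 2) ^ 2 - 4 * X) = 1) :
    ∃ L : PowerSeries ℝ, (1 + X - X ^ 2) * L = 1 + X * L ^ 2 ∧
      S * (1 + X - X ^ 2 - 2 * (X * L)) = 1 := by
  set D : PowerSeries ℝ := (1 + X - X ^ 2) ^ 2 - 4 * X with hD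
  have hdvd : (X : PowerSeries ℝ) ∣ (1 + X - X ^ 2) - S * D := by
    rw [X_dvd_iff]
    simp [hD, hS]
  obtain ⟨M, hM⟩ := hdvd
  have hC : (2 : PowerSeries ℝ) * C (1 / 2) = 1 := by
    rw [show (2 : PowerSeries ℝ) = C 2 from (map_ofNat C 2).symm, ← map_mul]
    norm_num
  set c : PowerSeries ℝ := C (1 / 2)
  have hSL : S * (1 + X - X ^ 2 - 2 * (X * (c * M))) = 1 := by
    linear_combination S * hM - S * X * M * hC + hS2
  refine ⟨c * M, ?_, hSL⟩
  have hX : (X : PowerSeries ℝ) ≠ 0 := X_ne_zero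
  have h4 : (4 * X : PowerSeries ℝ) ≠ 0 := by
    refine mul_ne_zero (fun h => ?_) hX
    have : (C (4 : ℝ) : PowerSeries ℝ) = 0 := by rw [← h]; exact map_ofNat C 4
    simpa using congrArg constantCoeff this
  have hsq : (1 + X - X ^ 2 - 2 * (X * (c * M))) ^ 2 = D := by
    linear_combination D * (S * (1 + X - X ^ 2 - 2 * (X * (c * M))) + 1) * hSL -
      (1 + X - X ^ 2 - 2 * (X * (c * M))) ^ 2 * hS2
  apply mul_left_cancel₀ h4
  linear_combination (-1) * hsq + hD

end Diagonal
lemma rescale_centralSeries_sq (a : ℝ) :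
    rescale a centralSeries ^ 2 * (1 - C a * X) = 1 := by
  have h := congrArg (rescale a) centralSeries_sq
  simpa [rescale_X] using h

/-- The power series of `(1 - X ^ 3) ^ (-1/2)`. -/
noncomputable def centralSeriesCube : PowerSeries ℝ :=
  expand 3 three_ne_zero centralSeries

lemma centralSeriesCube_sq : centralSeriesCube ^ 2 * (1 - X ^ 3) = 1 := by
  have h := congrArg (expand 3 three_ne_zero) centralSeries_sq
  simpa [centralSeriesCube] using h

lemma coeff_centralSeriesCube_nonneg (n : ℕ) : 0 ≤ coeff n centralSeriesCube := by
  rw [centralSeriesCube, coeff_expand]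
  split_ifs
  · exact (coeff_centralSeries_pos _).le
  · exact le_rfl

lemma coeff_centralSeriesCube_le_one (n : ℕ) : coeff n centralSeriesCube ≤ 1 := by
  rw [centralSeriesCube, coeff_expand]
  split_ifs
  · exact coeff_centralSeries_le_one _
  · exact zero_le_one

lemma constantCoeff_centralSeriesCube : constantCoeff centralSeriesCube = 1 := by
  simp [centralSeriesCube, constantCoeff_centralSeries]

/-- The number `(3 - √5) / 2`, the smaller root of `1 - 3 X + X ^ 2`. -/
noncomputable def smallRoot : ℝ := (3 - √5) / 2

lemma smallRoot_pos : 0 < smallRoot := by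
  have : √5 < 3 := by rw [Real.sqrt_lt' (by norm_num)]; norm_num
  unfold smallRoot
  linarith

lemma smallRoot_lt : smallRoot < 1 / 2 := by
  have : 2 < √5 := by rw [Real.lt_sqrt (by norm_num)]; norm_num
  unfold smallRoot
  linarith

lemma smallRoot_quadratic : 1 - 3 * smallRoot + smallRoot ^ 2 = 0 := by
  have : √5 ^ 2 = 5 := Real.sq_sqrt (by norm_num)
  unfold smallRoot
  linear_combination this / 4

/-- The power series of `((1 - ω X) (1 - X / ω) (1 + X + X ^ 2)) ^ (-1/2)`. -/
noncomputable def diagSeries : PowerSeries ℝ :=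
  (1 - X) * centralSeries * centralSeriesCube * rescale smallRoot centralSeries *
    rescale smallRoot⁻¹ centralSeries

/-- The power series of `((1 + X + X ^ 2) / (1 - ω X)) ^ (1/2)`. -/
noncomputable def regularFactor : PowerSeries ℝ :=
  (1 - X ^ 3) * centralSeries * centralSeriesCube * rescale smallRoot centralSeries

lemma mul_diagSeries :
    (1 + X + X ^ 2) * diagSeries = regularFactor * rescale smallRoot⁻¹ centralSeries := by
  unfold diagSeries regularFactor
  ring

lemma constantCoeff_diagSeries : constantCoeff diagSeries = 1 := by
  have h (a : ℝ) : constantCoeff (rescale a centralSeries) = 1 := by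
    rw [← coeff_zero_eq_constantCoeff_apply, coeff_rescale]
    simp [constantCoeff_centralSeries]
  simp [diagSeries, h, constantCoeff_centralSeries, constantCoeff_centralSeriesCube]

lemma diagSeries_sq : diagSeries ^ 2 * ((1 + X - X ^ 2) ^ 2 - 4 * X) = 1 := by
  have h1 := rescale_centralSeries_sq smallRoot
  have h2 := rescale_centralSeries_sq smallRoot⁻¹
  have h12 : rescale smallRoot centralSeries ^ 2 * rescale smallRoot⁻¹ centralSeries ^ 2 *
      (1 - 3 * X + X ^ 2) = 1 := by
    have hne := smallRoot_pos.ne'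
    have hs : C smallRoot + C smallRoot⁻¹ = (3 : PowerSeries ℝ) := by
      rw [← map_add, ← map_ofNat C 3]
      congr 1
      field_simp
      linear_combination smallRoot_quadratic
    have hp : C smallRoot * C smallRoot⁻¹ = (1 : PowerSeries ℝ) := by
      rw [← map_mul, mul_inv_cancel₀ hne, map_one]
    have hq : (1 - C smallRoot * X) * (1 - C smallRoot⁻¹ * X) =
        1 - 3 * X + (X : PowerSeries ℝ) ^ 2 := by
      linear_combination (-X) * hs + X ^ 2 * hp
    rw [← hq, mul_mul_mul_comm, h1, h2, one_mul]
  have h3 : ((1 - X) * centralSeries * centralSeriesCube) ^ 2 * (1 + X + X ^ 2) = 1 := by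
    linear_combination centralSeries ^ 2 * (1 - X) * centralSeriesCube_sq + centralSeries_sq
  calc diagSeries ^ 2 * ((1 + X - X ^ 2) ^ 2 - 4 * X)
      = (((1 - X) * centralSeries * centralSeriesCube) ^ 2 * (1 + X + X ^ 2)) *
        (rescale smallRoot centralSeries ^ 2 * rescale smallRoot⁻¹ centralSeries ^ 2 *
          (1 - 3 * X + X ^ 2)) := by unfold diagSeries; ring
    _ = 1 := by rw [h12, h3, one_mul]

lemma regularFactor_sq : regularFactor ^ 2 * (1 - C smallRoot * X) = 1 + X + X ^ 2 := by
  have h3 : ((1 - X ^ 3) * centralSeries * centralSeriesCube) ^ 2 = 1 + X + X ^ 2 := by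
    linear_combination (1 - X ^ 3) * centralSeries ^ 2 * centralSeriesCube_sq +
      (1 + X + X ^ 2) * centralSeries_sq
  rw [regularFactor, mul_pow, mul_assoc, rescale_centralSeries_sq, h3, mul_one]

lemma one_sub_monomial_eq (a : ℝ) (k : ℕ) :
    1 - C a * X ^ k = (monomial 0 1 + monomial k (-a) : PowerSeries ℝ) := by
  ext n
  rw [map_sub, map_add, coeff_one, coeff_C_mul, coeff_X_pow, coeff_monomial, coeff_monomial]
  split_ifs <;> ring

lemma absConv_one_sub (r a : ℝ) (k : ℕ) : AbsConv r (1 - C a * X ^ k) := by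
  rw [one_sub_monomial_eq]
  exact (absConv_monomial _ _ _).add (absConv_monomial _ _ _)

lemma value_one_sub (r a : ℝ) (k : ℕ) : value r (1 - C a * X ^ k) = 1 - a * r ^ k := by
  rw [one_sub_monomial_eq, value_add (absConv_monomial _ _ _) (absConv_monomial _ _ _),
    value_monomial, value_monomial]
  ring

section Value

variable {r : ℝ}

lemma absConv_centralSeries (h0 : 0 ≤ r) (h1 : r < 1) : AbsConv r centralSeries :=
  absConv_of_abs_coeff_le_one h0 h1 fun n => by
    rw [abs_of_pos (coeff_centralSeries_pos n)]
    exact coeff_centralSeries_le_one n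

lemma absConv_centralSeriesCube (h0 : 0 ≤ r) (h1 : r < 1) : AbsConv r centralSeriesCube :=
  absConv_of_abs_coeff_le_one h0 h1 fun n => by
    rw [abs_of_nonneg (coeff_centralSeriesCube_nonneg n)]
    exact coeff_centralSeriesCube_le_one n

lemma coeff_rescale_centralSeries_nonneg {a : ℝ} (ha : 0 ≤ a) (n : ℕ) :
    0 ≤ coeff n (rescale a centralSeries) := by
  rw [coeff_rescale]
  exact mul_nonneg (pow_nonneg ha n) (coeff_centralSeries_pos n).le

lemma absConv_rescale_centralSeries {a : ℝ} (ha : 0 ≤ a) (ha' : a ≤ 1)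
    (h0 : 0 ≤ r) (h1 : r < 1) :
    AbsConv r (rescale a centralSeries) :=
  absConv_of_abs_coeff_le_one h0 h1 fun n => by
    rw [abs_of_nonneg (coeff_rescale_centralSeries_nonneg ha n), coeff_rescale]
    exact mul_le_one₀ (pow_le_one₀ ha ha') (coeff_centralSeries_pos n).le
      (coeff_centralSeries_le_one n)

lemma absConv_regularFactor (h0 : 0 ≤ r) (h1 : r < 1) : AbsConv r regularFactor := by
  have h := absConv_one_sub r 1 3
  rw [map_one, one_mul] at h
  exact ((h.mul (absConv_centralSeries h0 h1)).mul (absConv_centralSeriesCube h0 h1)).mul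
    (absConv_rescale_centralSeries smallRoot_pos.le (smallRoot_lt.le.trans (by norm_num)) h0 h1)

lemma value_regularFactor_pos (h0 : 0 ≤ r) (h1 : r < 1) : 0 < value r regularFactor := by
  have h := absConv_one_sub r 1 3
  have hv := value_one_sub r 1 3
  rw [map_one, one_mul] at h hv
  have hB := absConv_centralSeries h0 h1
  have hE := absConv_centralSeriesCube h0 h1
  have hR := absConv_rescale_centralSeries smallRoot_pos.le
    (smallRoot_lt.le.trans (by norm_num)) h0 h1
  rw [regularFactor, value_mul ((h.mul hB).mul hE) hR, value_mul (h.mul hB) hE, value_mul h hB, hv]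
  have h3 : r ^ 3 < 1 := pow_lt_one₀ h0 h1 (by norm_num)
  refine mul_pos (mul_pos (mul_pos (by linarith) ?_) ?_) ?_
  · exact value_pos h0 hB (fun n => (coeff_centralSeries_pos n).le)
      (by rw [constantCoeff_centralSeries]; exact one_pos)
  · exact value_pos h0 hE coeff_centralSeriesCube_nonneg
      (by rw [constantCoeff_centralSeriesCube]; exact one_pos)
  · refine value_pos h0 hR (coeff_rescale_centralSeries_nonneg smallRoot_pos.le) ?_
    rw [← coeff_zero_eq_constantCoeff_apply, coeff_rescale]
    simp [constantCoeff_centralSeries]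

lemma sq_value_regularFactor (h0 : 0 ≤ r) (h1 : r < 1) :
    value r regularFactor ^ 2 * (1 - smallRoot * r) = 1 + r + r ^ 2 := by
  have hp := absConv_regularFactor h0 h1
  have hl := absConv_one_sub r smallRoot 1
  have hv := value_one_sub r smallRoot 1
  rw [pow_one] at hl hv
  have h := congrArg (value r) regularFactor_sq
  rw [sq, value_mul (hp.mul hp) hl, value_mul hp hp, hv, pow_one] at h
  have hr : (1 + X + X ^ 2 : PowerSeries ℝ) = monomial 0 1 + monomial 1 1 + monomial 2 1 := by
    rw [X_eq, monomial_pow]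
    simp
  have hm := absConv_monomial r 1
  rw [hr, value_add ((hm 0).add (hm 1)) (hm 2), value_add (hm 0) (hm 1), value_monomial,
    value_monomial, value_monomial] at h
  linear_combination h

end Value

lemma value_regularFactor_smallRoot : value smallRoot regularFactor = 2 / √√5 := by
  have h0 := smallRoot_pos
  have h1 : smallRoot < 1 := smallRoot_lt.trans (by norm_num)
  have h := sq_value_regularFactor h0.le h1
  have hpos := value_regularFactor_pos h0.le h1
  have h5 : √5 ^ 2 = 5 := Real.sq_sqrt (by norm_num)
  have h5' : 0 < √5 := by positivity
  have hs : value smallRoot regularFactor ^ 2 * √5 = 4 := by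
    have hw : 1 - smallRoot * smallRoot = √5 * smallRoot := by
      unfold smallRoot
      linear_combination h5 / 4
    have hn : 1 + smallRoot + smallRoot ^ 2 = 4 * smallRoot := by
      linear_combination smallRoot_quadratic
    rw [hw, hn] at h
    exact mul_right_cancel₀ h0.ne' (by linear_combination h)
  rw [eq_div_iff (by positivity)]
  refine (pow_left_inj₀ (by positivity) (by norm_num) two_ne_zero).mp ?_
  rw [mul_pow, Real.sq_sqrt h5'.le, hs]
  norm_num

/-- The generating function of balanced zigzag-free words. -/
lemma extCount_nil_eq_coeff (n : ℕ) :
    (extCount [] (n + 1) (n + 1) : ℝ) = coeff (n + 1) ((1 + X + X ^ 2) * diagSeries) := by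
  obtain ⟨L, hL, hSL⟩ := exists_diagonal_root constantCoeff_diagSeries diagSeries_sq
  have h := (isExtRec_diagCoeff constantCoeff_diagSeries hL hSL).extCount_eq
    (n + (n + 1)) n (n + 1) rfl
  rw [extCount_nil_succ_succ, ← two_mul_diagCoeff hSL]
  push_cast
  rw [h.1, h.2, two_mul]

lemma tendsto_extCount_nil :
    Tendsto (fun n : ℕ => (extCount [] n n : ℝ) * smallRoot ^ n * √(√5 * Real.pi * n) / 2)
      atTop (𝓝 1) := by
  have h0 := smallRoot_pos
  have h := tendsto_coeff_mul_rescale h0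
    (absConv_regularFactor (r := 3 / 2 * smallRoot) (by positivity) (by linarith [smallRoot_lt]))
  have h' := h.mul_const (√√5 * √Real.pi / 2)
  rw [value_regularFactor_smallRoot] at h'
  have hpi := Real.pi_pos
  have e : 2 / √√5 * (1 / √Real.pi) * (√√5 * √Real.pi / 2) = 1 := by
    field_simp
  rw [e] at h'
  refine h'.congr' ?_
  filter_upwards [eventually_gt_atTop 0] with n hn
  obtain ⟨n, rfl⟩ := Nat.exists_eq_succ_of_ne_zero hn.ne'
  rw [Nat.succ_eq_add_one, extCount_nil_eq_coeff, mul_diagSeries, Real.sqrt_mul (by positivity),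
    Real.sqrt_mul (by positivity)]
  ring

end ZigzagFree

/-- Let fₙ be the number of binary words of length 2n with exactly n zeros and
n ones and no factor 010 or 101. Then fₙ · ωⁿ · √(√5·π·n)/2 → 1 with
ω = (3 − √5)/2, i.e. fₙ ~ (2/(3 − √5))ⁿ · 2/√(√5·π·n). -/
theorem stmt8 (f : ℕ → ℕ)
    (hf : ∀ n : ℕ, f n = Nat.card {w : Fin (2 * n) → Fin 2 //
      ((Finset.univ.filter fun i => w i = 0).card = n) ∧
      ((Finset.univ.filter fun i => w i = 1).card = n) ∧
      (∀ i : ℕ, ∀ h : i + 2 < 2 * n,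
        ¬((w ⟨i, by omega⟩ = 0 ∧ w ⟨i + 1, by omega⟩ = 1 ∧ w ⟨i + 2, by omega⟩ = 0) ∨
          (w ⟨i, by omega⟩ = 1 ∧ w ⟨i + 1, by omega⟩ = 0 ∧ w ⟨i + 2, by omega⟩ = 1)))}) :
    Filter.Tendsto (fun n : ℕ =>
        (f n : ℝ) * ((3 - Real.sqrt 5) / 2) ^ n *
          Real.sqrt (Real.sqrt 5 * Real.pi * n) / 2)
      Filter.atTop (nhds 1) := by
  have h : ∀ n, f n = ZigzagFree.extCount [] n n := by
    intro n
    rw [hf, ZigzagFree.extCount, ← two_mul]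
    refine Nat.card_congr (Equiv.subtypeEquivRight fun w => ?_)
    beta_reduce
    rw [ZigzagFree.count_ofFn, ZigzagFree.count_ofFn, List.nil_append,
      ZigzagFree.isZigzagFree_ofFn]
  simp_rw [h]
  exact ZigzagFree.tendsto_extCount_nil
end

section
/- Define the Delannoy numbers D : ℕ × ℕ → ℕ by D(m,0) = D(0,n) = 1 and D(m,n) = D(m−1,n) + D(m,n−1) + D(m−1,n−1) for m,n ≥ 1. Let a, b be positive integers and L = √(a² + b²). Then as n → ∞, D(an, bn) is asymptotically equivalent to ((L − b)/a)^{−an} · ((L − a)/b)^{−bn} · √( ab / (L·(a + b − L)²·2πn) ); that is, the ratio of D(an,bn) to this expression tends to 1. -/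
open Filter Topology MeasureTheory

/-- The characteristic function of the Bernoulli distribution with parameter `p`. -/
noncomputable def bernoulliCharFun (p θ : ℝ) : ℂ := (1 - p) + p * Complex.exp (θ * Complex.I)

lemma continuous_bernoulliCharFun (p : ℝ) : Continuous (bernoulliCharFun p) := by
  unfold bernoulliCharFun
  fun_prop

lemma norm_bernoulliCharFun_le {p θ : ℝ} (hp0 : 0 ≤ p) (hp1 : p ≤ 1) (hθ : |θ| ≤ Real.pi) :
    ‖bernoulliCharFun p θ‖ ≤ Real.exp (-(2 / Real.pi ^ 2 * (p * (1 - p))) * θ ^ 2) := by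
  have hsq : ‖bernoulliCharFun p θ‖ ^ 2 = 1 - 2 * (p * (1 - p)) * (1 - Real.cos θ) := by
    rw [← Complex.normSq_eq_norm_sq, Complex.normSq_apply]
    simp only [bernoulliCharFun, Complex.add_re, Complex.sub_re, Complex.one_re, Complex.ofReal_re,
      Complex.re_ofReal_mul, Complex.exp_ofReal_mul_I_re, Complex.add_im, Complex.sub_im,
      Complex.one_im, Complex.ofReal_im, Complex.im_ofReal_mul, Complex.exp_ofReal_mul_I_im]
    linear_combination p ^ 2 * Real.sin_sq_add_cos_sq θ
  refine le_of_sq_le_sq ?_ (Real.exp_pos _).le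
  have hcos := Real.cos_le_one_sub_mul_cos_sq hθ
  have hpp : 0 ≤ p * (1 - p) := mul_nonneg hp0 (by linarith)
  rw [hsq, ← Real.exp_nat_mul]
  refine le_trans ?_ (Real.add_one_le_exp _)
  push_cast
  nlinarith [mul_le_mul_of_nonneg_left hcos hpp]

lemma tendsto_mul_exp_div_sqrt_sub (c : ℝ) :
    Tendsto (fun n : ℕ => (n : ℂ) * (Complex.exp ((c / √n : ℝ) * Complex.I) - 1
      - (c / √n : ℝ) * Complex.I)) atTop (𝓝 (-(c : ℂ) ^ 2 / 2)) := by
  have h0 : Tendsto (fun n : ℕ => |c| / √(n : ℝ)) atTop (𝓝 0) :=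
    tendsto_const_nhds.div_atTop (Real.tendsto_sqrt_atTop.comp tendsto_natCast_atTop_atTop)
  have h1 : Tendsto (fun n : ℕ => c ^ 2 * (|c| / √(n : ℝ))) atTop (𝓝 0) := by
    simpa using h0.const_mul (c ^ 2)
  rw [tendsto_iff_norm_sub_tendsto_zero]
  refine squeeze_zero' (Eventually.of_forall fun _ => norm_nonneg _) ?_ h1
  filter_upwards [h0.eventually (gt_mem_nhds one_pos), eventually_gt_atTop 0] with n hn hn0
  have hn0' : (0 : ℝ) < n := by exact_mod_cast hn0
  set x : ℝ := c / √n with hx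
  have hxabs : |x| = |c| / √n := by rw [hx, abs_div, abs_of_nonneg (Real.sqrt_nonneg _)]
  have hxn : (n : ℝ) * x ^ 2 = c ^ 2 := by
    rw [hx, div_pow, Real.sq_sqrt hn0'.le]; field_simp
  have hb := Complex.exp_bound (x := (x : ℂ) * Complex.I) (n := 3)
    (by simpa [hxabs] using hn.le) (by norm_num)
  have heq : (n : ℂ) * (Complex.exp (x * Complex.I) - 1 - x * Complex.I) - -(c : ℂ) ^ 2 / 2
      = n * (Complex.exp (x * Complex.I)
        - ∑ m ∈ Finset.range 3, ((x : ℂ) * Complex.I) ^ m / m.factorial) := by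
    have hxn' : (n : ℂ) * (x : ℂ) ^ 2 = (c : ℂ) ^ 2 := by exact_mod_cast hxn
    simp only [Finset.sum_range_succ, Finset.sum_range_zero, Nat.factorial, mul_pow,
      Complex.I_sq]
    push_cast
    linear_combination -hxn' / 2
  rw [heq, norm_mul, Complex.norm_natCast, ← hxabs, ← hxn]
  have hb' : ‖Complex.exp (x * Complex.I)
        - ∑ m ∈ Finset.range 3, ((x : ℂ) * Complex.I) ^ m / m.factorial‖ ≤ |x| ^ 3 := by
    refine hb.trans ?_
    simp only [norm_mul, Complex.norm_real, Complex.norm_I, mul_one, Real.norm_eq_abs]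
    refine mul_le_of_le_one_right (by positivity) ?_
    norm_num [Nat.factorial]
  calc (n : ℝ) * _ ≤ n * |x| ^ 3 := by gcongr
    _ = n * x ^ 2 * |x| := by rw [← sq_abs x]; ring

lemma tendsto_bernoulliCharFun_pow (p u : ℝ) :
    Tendsto (fun n : ℕ => (bernoulliCharFun p (u / √n)
      * Complex.exp (-(p * (u / √n) : ℝ) * Complex.I)) ^ n) atTop
      (𝓝 (Complex.exp (-(p * (1 - p) * u ^ 2 / 2 : ℝ)))) := by
  have h := ((tendsto_mul_exp_div_sqrt_sub (-p * u)).const_mul (1 - p : ℂ)).add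
    ((tendsto_mul_exp_div_sqrt_sub ((1 - p) * u)).const_mul (p : ℂ))
  have h' : Tendsto (fun n : ℕ => (n : ℂ) * (bernoulliCharFun p (u / √n)
      * Complex.exp (-(p * (u / √n) : ℝ) * Complex.I) - 1)) atTop
      (𝓝 (-(p * (1 - p) * u ^ 2 / 2 : ℝ))) := by
    convert h using 2 with n
    · have e : Complex.exp (((1 - p) * u / √n : ℝ) * Complex.I)
          = Complex.exp ((u / √n : ℝ) * Complex.I)
            * Complex.exp (-(p * (u / √n) : ℝ) * Complex.I) := by
        rw [← Complex.exp_add]; congr 1; push_cast; ring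
      have e' : ((-p * u / √n : ℝ) : ℂ) = -(p * (u / √n) : ℝ) := by push_cast; ring
      rw [e, e', bernoulliCharFun]
      push_cast
      ring
    · push_cast; ring
  simpa using Complex.tendsto_one_add_pow_exp_of_tendsto h'

lemma tendsto_bernoulliCharFun_mul_pow {a b : ℕ} {p q : ℝ} (hpq : a * p = b * q) (u : ℝ) :
    Tendsto (fun n : ℕ =>
      (bernoulliCharFun p (u / √n) ^ a * bernoulliCharFun q (-(u / √n)) ^ b) ^ n)
      atTop (𝓝 (Real.exp (-((a * (p * (1 - p)) + b * (q * (1 - q))) / 2) * u ^ 2) : ℂ)) := by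
  have h := ((tendsto_bernoulliCharFun_pow p u).pow a).mul
    ((tendsto_bernoulliCharFun_pow q (-u)).pow b)
  convert h using 2 with n
  · have e : Complex.exp (-(p * (u / √n) : ℝ) * Complex.I) ^ a
        * Complex.exp (-(q * (-u / √n) : ℝ) * Complex.I) ^ b = 1 := by
      rw [← Complex.exp_nat_mul, ← Complex.exp_nat_mul, ← Complex.exp_add, ← Complex.exp_zero]
      congr 1
      have hpq' : (a : ℂ) * p = b * q := by exact_mod_cast hpq
      push_cast
      linear_combination (-(u / √n : ℂ) * Complex.I) * hpq'
    rw [← pow_mul, ← pow_mul, mul_comm n a, mul_comm n b, pow_mul, pow_mul, ← mul_pow, mul_pow _ _ a,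
      mul_pow _ _ b, mul_mul_mul_comm, e, mul_one, neg_div]
  · rw [← Complex.exp_nat_mul, ← Complex.exp_nat_mul, ← Complex.exp_add, Complex.ofReal_exp]
    congr 1
    push_cast
    ring

/-- A local limit theorem for the difference of two independent binomial variables
of equal mean. -/
lemma tendsto_sqrt_mul_integral_bernoulliCharFun {a b : ℕ} {p q : ℝ} (ha : 0 < a)
    (hp0 : 0 < p) (hp1 : p < 1) (hq0 : 0 ≤ q) (hq1 : q ≤ 1) (hpq : a * p = b * q) :
    Tendsto (fun n : ℕ => (√n : ℂ) * ∫ θ in -Real.pi..Real.pi,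
      (bernoulliCharFun p θ ^ a * bernoulliCharFun q (-θ) ^ b) ^ n) atTop
      (𝓝 (√(2 * Real.pi / (a * (p * (1 - p)) + b * (q * (1 - q)))) : ℝ)) := by
  set v : ℝ := a * (p * (1 - p)) + b * (q * (1 - q)) with hv
  have hv0 : 0 < v := by
    have h1 : 0 < (a : ℝ) * (p * (1 - p)) :=
      mul_pos (by exact_mod_cast ha) (mul_pos hp0 (by linarith))
    have h2 : 0 ≤ (b : ℝ) * (q * (1 - q)) :=
      mul_nonneg (Nat.cast_nonneg _) (mul_nonneg hq0 (by linarith))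
    linarith
  set f : ℝ → ℂ := fun θ => bernoulliCharFun p θ ^ a * bernoulliCharFun q (-θ) ^ b with hf
  have hfc : Continuous f :=
    ((continuous_bernoulliCharFun p).pow a).mul
      (((continuous_bernoulliCharFun q).comp continuous_neg).pow b)
  have hfb : ∀ θ, |θ| ≤ Real.pi → ‖f θ‖ ≤ Real.exp (-(2 / Real.pi ^ 2 * v) * θ ^ 2) := by
    intro θ hθ
    have h1 := norm_bernoulliCharFun_le hp0.le hp1.le hθ
    have h2 := norm_bernoulliCharFun_le hq0 hq1 (by rwa [abs_neg] : |-θ| ≤ Real.pi)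
    calc ‖f θ‖ = ‖bernoulliCharFun p θ‖ ^ a * ‖bernoulliCharFun q (-θ)‖ ^ b := by
          simp only [hf, norm_mul, norm_pow]
      _ ≤ Real.exp (-(2 / Real.pi ^ 2 * (p * (1 - p))) * θ ^ 2) ^ a
          * Real.exp (-(2 / Real.pi ^ 2 * (q * (1 - q))) * (-θ) ^ 2) ^ b := by gcongr
      _ = _ := by
          rw [← Real.exp_nat_mul, ← Real.exp_nat_mul, ← Real.exp_add, hv]
          congr 1
          ring
  let F : ℕ → ℝ → ℂ := fun n =>
    (Set.Ioc (√n * -Real.pi) (√n * Real.pi)).indicator fun u => f (u / √n) ^ n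
  have hF : Tendsto (fun n => ∫ u, F n u) atTop
      (𝓝 (∫ u : ℝ, (Real.exp (-(v / 2) * u ^ 2) : ℂ))) := by
    refine tendsto_integral_filter_of_dominated_convergence
      (fun u => Real.exp (-(2 / Real.pi ^ 2 * v) * u ^ 2)) ?_ ?_
      (integrable_exp_neg_mul_sq (by positivity)) ?_
    · refine Eventually.of_forall fun n => ?_
      exact ((hfc.comp (continuous_id.div_const _)).pow n).aestronglyMeasurable.indicator
        measurableSet_Ioc
    · filter_upwards [eventually_gt_atTop 0] with n hn
      have hn' : (0 : ℝ) < n := by exact_mod_cast hn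
      have hs : 0 < √(n : ℝ) := Real.sqrt_pos.2 hn'
      refine Eventually.of_forall fun u => ?_
      by_cases hu : u ∈ Set.Ioc (√n * -Real.pi) (√n * Real.pi)
      · simp only [F, Set.indicator_of_mem hu, norm_pow]
        have hθ : |u / √n| ≤ Real.pi := by
          rw [abs_div, abs_of_pos hs, div_le_iff₀ hs, abs_le]
          constructor <;> nlinarith [hu.1, hu.2]
        refine (pow_le_pow_left₀ (norm_nonneg _) (hfb _ hθ) n).trans_eq ?_
        rw [← Real.exp_nat_mul, div_pow, Real.sq_sqrt hn'.le]
        congr 1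
        field_simp
      · simp only [F, Set.indicator_of_notMem hu, norm_zero]
        positivity
    · refine Eventually.of_forall fun u => ?_
      refine (tendsto_bernoulliCharFun_mul_pow hpq u).congr' ?_
      have ht : Tendsto (fun n : ℕ => √(n : ℝ) * Real.pi) atTop atTop :=
        (Real.tendsto_sqrt_atTop.comp tendsto_natCast_atTop_atTop).atTop_mul_const Real.pi_pos
      filter_upwards [ht.eventually_gt_atTop |u|] with n hn
      have hu : u ∈ Set.Ioc (√n * -Real.pi) (√n * Real.pi) := by
        have := abs_lt.1 hn
        exact ⟨by linarith, by linarith⟩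
      simp only [F, Set.indicator_of_mem hu, hf]
  rw [integral_complex_ofReal, integral_gaussian] at hF
  rw [show Real.pi / (v / 2) = 2 * Real.pi / v by field_simp] at hF
  refine hF.congr' ?_
  filter_upwards [eventually_gt_atTop 0] with n hn
  have hs : 0 < √(n : ℝ) := Real.sqrt_pos.2 (by exact_mod_cast hn)
  have hle : √(n : ℝ) * -Real.pi ≤ √n * Real.pi := by nlinarith [Real.pi_pos]
  rw [integral_indicator measurableSet_Ioc, ← intervalIntegral.integral_of_le hle,
    intervalIntegral.integral_comp_div (fun θ => f θ ^ n) hs.ne',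
    mul_div_cancel_left₀ _ hs.ne', mul_div_cancel_left₀ _ hs.ne', Complex.real_smul]

/-- The mean value property of `(1 + z) ^ m` at the centre of the disc of radius `s`. -/
lemma integral_one_add_mul_exp_pow (s : ℝ) (m : ℕ) :
    ∫ θ in -Real.pi..Real.pi, (1 + s * Complex.exp (θ * Complex.I)) ^ m = 2 * Real.pi := by
  have h := DiffContOnCl.circleAverage (f := fun z : ℂ => (1 + z) ^ m) (c := 0) (R := s)
    (Differentiable.diffContOnCl (by fun_prop))
  rw [Real.circleAverage_eq_integral_add (-Real.pi),
    intervalIntegral.integral_comp_add_right (fun θ => (1 + circleMap 0 s θ) ^ m)] at h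
  rw [zero_add, show 2 * Real.pi + -Real.pi = Real.pi by ring, inv_smul_eq_iff₀ (by positivity)] at h
  simpa [circleMap] using h

lemma integral_one_add_mul_exp_neg_pow (t : ℝ) (n : ℕ) :
    ∫ θ in -Real.pi..Real.pi, (1 + t * Complex.exp (-θ * Complex.I)) ^ n = 2 * Real.pi := by
  have h := intervalIntegral.integral_comp_neg (a := -Real.pi) (b := Real.pi)
    (fun θ : ℝ => (1 + t * Complex.exp (θ * Complex.I)) ^ n)
  rw [neg_neg, integral_one_add_mul_exp_pow] at h
  simpa using h

/-- Delannoy numbers as constant terms: if `u = 1 + s z` and `v = 1 + t / z` with `s t = 2`, then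
`u v = u + v + 1`. -/
lemma integral_eq_delannoy {D : ℕ → ℕ → ℕ}
    (hD1 : ∀ m, D m 0 = 1) (hD2 : ∀ n, D 0 n = 1)
    (hD3 : ∀ m n, D (m + 1) (n + 1) = D m (n + 1) + D (m + 1) n + D m n)
    {s t : ℝ} (hst : s * t = 2) (m n : ℕ) :
    ∫ θ in -Real.pi..Real.pi, (1 + s * Complex.exp (θ * Complex.I)) ^ m
      * (1 + t * Complex.exp (-θ * Complex.I)) ^ n = 2 * Real.pi * D m n := by
  induction m generalizing n with
  | zero => simpa [hD2] using integral_one_add_mul_exp_neg_pow t n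
  | succ m ihm =>
    induction n with
    | zero => simpa [hD1] using integral_one_add_mul_exp_pow s (m + 1)
    | succ n ihn =>
      have hrec : ∀ θ : ℝ, (1 + s * Complex.exp (θ * Complex.I)) ^ (m + 1)
            * (1 + t * Complex.exp (-θ * Complex.I)) ^ (n + 1)
          = (1 + s * Complex.exp (θ * Complex.I)) ^ m
              * (1 + t * Complex.exp (-θ * Complex.I)) ^ (n + 1)
            + (1 + s * Complex.exp (θ * Complex.I)) ^ (m + 1)
              * (1 + t * Complex.exp (-θ * Complex.I)) ^ n
            + (1 + s * Complex.exp (θ * Complex.I)) ^ m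
              * (1 + t * Complex.exp (-θ * Complex.I)) ^ n := by
        intro θ
        have he : Complex.exp (θ * Complex.I) * Complex.exp (-θ * Complex.I) = 1 := by
          rw [← Complex.exp_add]; simp
        have hst' : (s : ℂ) * t = 2 := by exact_mod_cast hst
        linear_combination (1 + s * Complex.exp (θ * Complex.I)) ^ m
          * (1 + t * Complex.exp (-θ * Complex.I)) ^ n * (s * t * he + hst')
      simp_rw [hrec]
      have hint : ∀ i j : ℕ, IntervalIntegrable (fun θ : ℝ =>
          (1 + s * Complex.exp (θ * Complex.I)) ^ i
            * (1 + t * Complex.exp (-θ * Complex.I)) ^ j) volume (-Real.pi) Real.pi :=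
        fun i j => Continuous.intervalIntegrable (by fun_prop) _ _
      rw [intervalIntegral.integral_add ((hint _ _).add (hint _ _)) (hint _ _),
        intervalIntegral.integral_add (hint _ _) (hint _ _), ihm, ihn, ihm, hD3]
      push_cast
      ring

lemma bernoulliCharFun_eq {s : ℝ} (hs : 1 + s ≠ 0) (θ : ℝ) :
    ((1 + s : ℝ) : ℂ) * bernoulliCharFun (s / (1 + s)) θ = 1 + s * Complex.exp (θ * Complex.I) := by
  have hs' : (1 + s : ℂ) ≠ 0 := by exact_mod_cast hs
  rw [bernoulliCharFun]
  push_cast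
  field_simp
  ring

lemma tendsto_sqrt_mul_delannoy {D : ℕ → ℕ → ℕ}
    (hD1 : ∀ m, D m 0 = 1) (hD2 : ∀ n, D 0 n = 1)
    (hD3 : ∀ m n, D (m + 1) (n + 1) = D m (n + 1) + D (m + 1) n + D m n)
    {a b : ℕ} (ha : 0 < a) {s t : ℝ} (hs : 0 < s) (ht : 0 < t) (hst : s * t = 2)
    (hab : a * (s / (1 + s)) = b * (t / (1 + t))) :
    Tendsto (fun n : ℕ => √n * (D (a * n) (b * n) / ((1 + s) ^ (a * n) * (1 + t) ^ (b * n))))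
      atTop (𝓝 (√(2 * Real.pi / (a * (s / (1 + s) * (1 - s / (1 + s)))
        + b * (t / (1 + t) * (1 - t / (1 + t))))) / (2 * Real.pi))) := by
  have h := tendsto_sqrt_mul_integral_bernoulliCharFun ha (p := s / (1 + s)) (q := t / (1 + t))
    (by positivity) (by rw [div_lt_one (by positivity)]; linarith) (by positivity)
    (by rw [div_le_one (by positivity)]; linarith) hab
  rw [← tendsto_ofReal_iff]
  have h' := h.div_const (2 * Real.pi : ℂ)
  push_cast at h' ⊢
  refine h'.congr fun n => ?_
  have hs1 : (1 + s : ℂ) ≠ 0 := by exact_mod_cast (by positivity : 1 + s ≠ 0)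
  have ht1 : (1 + t : ℂ) ≠ 0 := by exact_mod_cast (by positivity : 1 + t ≠ 0)
  have hπ : (Real.pi : ℂ) ≠ 0 := by exact_mod_cast Real.pi_ne_zero
  have hD : ∫ θ in -Real.pi..Real.pi, (bernoulliCharFun (s / (1 + s)) θ ^ a
        * bernoulliCharFun (t / (1 + t)) (-θ) ^ b) ^ n
      = ((1 + s) ^ (a * n) * (1 + t) ^ (b * n) : ℂ)⁻¹ * (2 * Real.pi * D (a * n) (b * n)) := by
    rw [← integral_eq_delannoy hD1 hD2 hD3 hst, ← intervalIntegral.integral_const_mul]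
    refine intervalIntegral.integral_congr fun θ _ => ?_
    have h1 := bernoulliCharFun_eq (s := s) (by positivity) θ
    have h2 := bernoulliCharFun_eq (s := t) (by positivity) (-θ)
    rw [Complex.ofReal_neg] at h2
    rw [← h1, ← h2]
    push_cast
    rw [mul_pow, mul_pow, mul_pow, ← pow_mul, ← pow_mul]
    field_simp
  rw [hD]
  field_simp

/-- Asymptotics of the Delannoy numbers along the direction (a,b):
D(an,bn) ~ ((L−b)/a)^{−an} · ((L−a)/b)^{−bn} · √(ab/(L·(a+b−L)²·2πn)),
where L = √(a² + b²). -/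
theorem stmt12 (D : ℕ → ℕ → ℕ)
    (hD1 : ∀ m, D m 0 = 1) (hD2 : ∀ n, D 0 n = 1)
    (hD3 : ∀ m n, D (m + 1) (n + 1) = D m (n + 1) + D (m + 1) n + D m n)
    (a b : ℕ) (ha : 0 < a) (hb : 0 < b)
    (L : ℝ) (hL : L = Real.sqrt ((a : ℝ) ^ 2 + (b : ℝ) ^ 2)) :
    Filter.Tendsto (fun n : ℕ => (D (a * n) (b * n) : ℝ) /
        (((L - b) / a) ^ (-((a * n : ℕ) : ℤ)) * ((L - a) / b) ^ (-((b * n : ℕ) : ℤ)) *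
          Real.sqrt (((a : ℝ) * b) / (L * (a + b - L) ^ 2 * 2 * Real.pi * n))))
      Filter.atTop (nhds 1) := by
  have ha' : (0 : ℝ) < a := by exact_mod_cast ha
  have hb' : (0 : ℝ) < b := by exact_mod_cast hb
  have hL2 : L ^ 2 = (a : ℝ) ^ 2 + (b : ℝ) ^ 2 := by rw [hL, Real.sq_sqrt (by positivity)]
  have hL0 : 0 < L := by rw [hL]; positivity
  have hLa : (a : ℝ) < L := by nlinarith
  have hLb : (b : ℝ) < L := by nlinarith
  have hc : 0 < a + b - L := by nlinarith [mul_pos ha' hb']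
  set s : ℝ := (L + b - a) / a with hs
  set t : ℝ := (L + a - b) / b with ht
  have hs0 : 0 < s := div_pos (by linarith) ha'
  have ht0 : 0 < t := div_pos (by linarith) hb'
  have hst : s * t = 2 := by
    rw [hs, ht]; field_simp; linear_combination hL2
  have hs1 : 1 + s = ((L - b) / a)⁻¹ := by
    rw [hs, inv_div, eq_div_iff (by linarith)]; field_simp; linear_combination hL2
  have ht1 : 1 + t = ((L - a) / b)⁻¹ := by
    rw [ht, inv_div, eq_div_iff (by linarith)]; field_simp; linear_combination hL2
  have hp : s / (1 + s) = (a + b - L) / a := by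
    rw [hs1, hs, div_inv_eq_mul]; field_simp; linear_combination hL2
  have hq : t / (1 + t) = (a + b - L) / b := by
    rw [ht1, ht, div_inv_eq_mul]; field_simp; linear_combination hL2
  have h := tendsto_sqrt_mul_delannoy hD1 hD2 hD3 (b := b) ha hs0 ht0 hst
    (by rw [hp, hq]; field_simp)
  set K : ℝ := a * b / (L * (a + b - L) ^ 2) with hK
  have hK0 : 0 < K := by positivity
  have hv : a * (s / (1 + s) * (1 - s / (1 + s))) + b * (t / (1 + t) * (1 - t / (1 + t)))
      = K⁻¹ := by
    rw [hp, hq, hK, inv_div]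
    field_simp
    linear_combination hL2
  rw [hv, div_inv_eq_mul] at h
  have h2 := h.div_const √(K / (2 * Real.pi))
  have hlim : √(2 * Real.pi * K) / (2 * Real.pi) / √(K / (2 * Real.pi)) = 1 := by
    rw [div_div, div_eq_one_iff_eq (by positivity), Real.sqrt_eq_iff_mul_self_eq (by positivity)
      (by positivity)]
    rw [mul_mul_mul_comm, Real.mul_self_sqrt (by positivity)]
    field_simp
  rw [hlim] at h2
  refine h2.congr' ?_
  filter_upwards [eventually_gt_atTop 0] with n hn
  have hn' : (0 : ℝ) < n := by exact_mod_cast hn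
  have hsqrt : √((a : ℝ) * b / (L * (a + b - L) ^ 2 * 2 * Real.pi * n))
      = √(K / (2 * Real.pi)) / √n := by
    rw [← Real.sqrt_div (by positivity), hK]
    congr 1
    field_simp
  have hsn : √(n : ℝ) ≠ 0 := (Real.sqrt_pos.2 hn').ne'
  rw [hsqrt, zpow_neg, zpow_neg, zpow_natCast, zpow_natCast, ← inv_pow, ← inv_pow, ← hs1, ← ht1]
  field_simp
end

section
/- Let d ≥ 1 and J(x_1,…,x_d) = 1 − (1/2)·∏_{i=1}^d (1 + x_i) on ℂ^d, with partial derivatives J_i(x) = −(1/2)·∏_{j≠i}(1 + x_j). The set of points x ∈ ℂ^d satisfying J(x) = 0 and x_i·J_i(x) = x_d·J_d(x) for all i < d is exactly { (2^{1/d}·ω − 1)·(1,…,1) : ω ∈ ℂ, ω^d = 1 }, where 2^{1/d} denotes the positive real d-th root of 2. -/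
/-- For J(x) = 1 − (1/2)·∏(1 + xᵢ) on ℂ^d, the critical points for the main
diagonal direction are exactly the points (2^{1/d}·ω − 1)·(1,…,1) with ω ranging
over the d-th roots of unity. -/
theorem stmt16 (d : ℕ) (hd : 1 ≤ d)
    (J : (Fin d → ℂ) → ℂ) (hJ : ∀ x, J x = 1 - (1 / 2) * ∏ i, (1 + x i))
    (Jp : Fin d → (Fin d → ℂ) → ℂ)
    (hJp : ∀ i x, Jp i x = -(1 / 2) * ∏ j ∈ Finset.univ.erase i, (1 + x j))
    (dd : Fin d) (hdd : dd = ⟨d - 1, by omega⟩) :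
    {x : Fin d → ℂ | J x = 0 ∧ ∀ i : Fin d, (i : ℕ) < d - 1 →
        x i * Jp i x = x dd * Jp dd x} =
      {x : Fin d → ℂ | ∃ ω : ℂ, ω ^ d = 1 ∧
        x = fun _ => (((2 : ℝ) ^ ((1 : ℝ) / d) : ℝ) : ℂ) * ω - 1} := by
  subst hdd
  set c : ℂ := (((2 : ℝ) ^ ((1 : ℝ) / d) : ℝ) : ℂ) with hc
  have hcd : c ^ d = 2 := by
    rw [hc, ← Complex.ofReal_pow, one_div, Real.rpow_inv_natCast_pow (by norm_num) (by omega)]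
    norm_num
  have hc0 : c ≠ 0 := by
    rintro h
    rw [h, zero_pow (by omega)] at hcd
    norm_num at hcd
  ext x
  simp only [Set.mem_ofPred_eq, hJ, hJp]
  constructor
  · rintro ⟨h1, h2⟩
    have hP : ∏ i, (1 + x i) = 2 := by linear_combination -2 * h1
    have hQ (i : Fin d) : (1 + x i) * ∏ j ∈ Finset.univ.erase i, (1 + x j) = 2 := by
      rw [Finset.mul_prod_erase _ (fun j => 1 + x j) (Finset.mem_univ i), hP]
    have hx (i : Fin d) : x i = x ⟨d - 1, by omega⟩ := by
      by_cases hi : (i : ℕ) < d - 1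
      · have e := h2 i hi
        have e1 := hQ i
        have e2 := hQ ⟨d - 1, by omega⟩
        generalize ∏ j ∈ Finset.univ.erase i, (1 + x j) = a at *
        generalize ∏ j ∈ Finset.univ.erase (⟨d - 1, by omega⟩ : Fin d), (1 + x j) = b at *
        have hab : a = b := by linear_combination e1 - e2 + 2 * e
        subst hab
        have ha : a ≠ 0 := by
          rintro rfl
          norm_num at e1
        exact mul_right_cancel₀ ha (by linear_combination e1 - e2)
      · congr 1
        ext
        simp only
        omega
    refine ⟨(1 + x ⟨d - 1, by omega⟩) / c, ?_, ?_⟩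
    · rw [div_pow, hcd, ← hP, Finset.prod_congr rfl fun i _ => by rw [hx i]]
      rw [Finset.prod_const, Finset.card_univ, Fintype.card_fin, div_self]
      rw [Finset.prod_congr rfl fun i _ => by rw [hx i], Finset.prod_const, Finset.card_univ,
        Fintype.card_fin] at hP
      rw [hP]
      norm_num
    · funext i
      rw [hx i, mul_div_cancel₀ _ hc0]
      ring
  · rintro ⟨ω, hω, rfl⟩
    refine ⟨?_, fun i _ => ?_⟩
    · simp [mul_pow, hcd, hω]
    · simp [Finset.prod_const, Finset.card_erase_of_mem]
end

section
/- For integers d ≥ 2 and n ≥ 1, let A_d(n) be the number of pairs (k, M) where k ≥ 0 and M is a d×k matrix with entries in {0,1} such that every row of M sums to n and no column of M is the zero column. Then as n → ∞, A_d(n) is asymptotically equivalent to (2^{1/d} − 1)^{−dn} · 1/( (2^{1/d} − 1) · 2^{(d² − 1)/(2d)} · √( d·(πn)^{d−1} ) ); that is, the ratio of A_d(n) to this expression tends to 1. -/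
open Finset in
/-- Families of `d` subsets of `α`, each of size `n`, with union `s`. -/
def unionFamilies (d n : ℕ) {α : Type*} [Fintype α] [DecidableEq α] (s : Finset α) :
    Finset (Fin d → Finset α) :=
  {f | (∀ i, #(f i) = n) ∧ univ.biUnion f = s}

open Finset in
lemma card_unionFamilies_map (d n : ℕ) {α β : Type*} [Fintype α] [DecidableEq α] [Fintype β]
    [DecidableEq β] (e : β ↪ α) :
    #(unionFamilies d n (univ.map e)) = #(unionFamilies d n (univ : Finset β)) := by
  symm
  refine card_bij (fun f _ i => (f i).map e) ?_ ?_ ?_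
  · intro f hf
    simp only [unionFamilies, mem_filter, mem_univ, true_and, card_map] at hf ⊢
    refine ⟨hf.1, ?_⟩
    rw [← hf.2]
    ext a
    simp only [mem_biUnion, mem_map, mem_univ, true_and]
    grind
  · intro f _ g _ h
    funext i
    exact map_injective e (congrFun h i)
  · intro f hf
    simp only [unionFamilies, mem_filter, mem_univ, true_and] at hf
    have hsub : ∀ i, ∃ u ⊆ univ, f i = u.map e := fun i =>
      subset_map_iff.1 (hf.2 ▸ subset_biUnion_of_mem f (mem_univ i))
    choose u _ hu using hsub
    refine ⟨u, ?_, funext fun i => (hu i).symm⟩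
    simp only [unionFamilies, mem_filter, mem_univ, true_and]
    refine ⟨fun i => by rw [← card_map e, ← hu, hf.1], ?_⟩
    apply map_injective e
    rw [← hf.2]
    ext a
    simp only [mem_biUnion, mem_map, mem_univ, true_and, hu]
    grind

open Finset in
lemma card_unionFamilies (d n : ℕ) {α : Type*} [Fintype α] [DecidableEq α] (s : Finset α) :
    #(unionFamilies d n s) = #(unionFamilies d n (univ : Finset (Fin #s))) := by
  rw [← card_unionFamilies_map d n
    (s.equivFin.symm.toEmbedding.trans (Function.Embedding.subtype _))]
  congr
  ext a
  simp only [mem_map, mem_univ, true_and]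
  constructor
  · exact fun ha => ⟨s.equivFin ⟨a, ha⟩, by simp⟩
  · rintro ⟨j, rfl⟩
    simp

open Finset in
lemma unionFamilies_card_eq_zero {d n k : ℕ} (h : d * n < k) :
    #(unionFamilies d n (univ : Finset (Fin k))) = 0 := by
  rw [card_eq_zero, eq_empty_iff_forall_notMem]
  intro f hf
  simp only [unionFamilies, mem_filter, mem_univ, true_and] at hf
  have h1 : #(univ.biUnion f) ≤ ∑ i, #(f i) := card_biUnion_le
  simp [hf.1, hf.2] at h1
  omega

open Finset in
lemma choose_pow_eq_sum (d n m : ℕ) :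
    m.choose n ^ d = ∑ k ∈ range (d * n + 1),
      m.choose k * #(unionFamilies d n (univ : Finset (Fin k))) := by
  have h1 : m.choose n ^ d =
      ∑ s ∈ (univ : Finset (Fin m)).powerset, #(unionFamilies d n s) := by
    have : m.choose n ^ d =
        #(Fintype.piFinset fun _ : Fin d => powersetCard n (univ : Finset (Fin m))) := by
      simp
    rw [this, card_eq_sum_card_fiberwise (f := fun f => univ.biUnion f)
      (t := (univ : Finset (Fin m)).powerset) (by intro f _; simp)]
    refine sum_congr rfl fun s _ => ?_
    congr 1
    ext f
    simp [unionFamilies, mem_powersetCard]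
  rw [h1, sum_congr rfl fun s _ => card_unionFamilies d n s,
    sum_powerset_apply_card fun k => #(unionFamilies d n (univ : Finset (Fin k)))]
  simp only [card_univ, Fintype.card_fin, smul_eq_mul]
  trans ∑ k ∈ range (m + 1 + (d * n + 1)),
      m.choose k * #(unionFamilies d n (univ : Finset (Fin k)))
  · refine sum_subset (range_mono (by omega)) fun k _ hk => ?_
    rw [Nat.choose_eq_zero_of_lt (by simpa using hk), zero_mul]
  · symm
    refine sum_subset (range_mono (by omega)) fun k _ hk => ?_
    rw [unionFamilies_card_eq_zero (by simp at hk; omega), mul_zero]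

/-- The number of alignments of `d` strings with `n` ones each. -/
lemma card_alignments (d n : ℕ) :
    Nat.card {p : (k : ℕ) × (Fin d → Fin k → Bool) //
      (∀ i, (Finset.univ.filter fun j => p.2 i j = true).card = n) ∧
      (∀ j, ∃ i, p.2 i j = true)} =
    ∑ k ∈ Finset.range (d * n + 1),
      (unionFamilies d n (Finset.univ : Finset (Fin k))).card := by
  rw [← Finset.card_sigma, ← Fintype.card_coe, ← Nat.card_eq_fintype_card]
  refine Nat.card_congr
    { toFun := fun p => ⟨⟨p.1.1, fun i => Finset.univ.filter fun j => p.1.2 i j = true⟩, ?_⟩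
      invFun := fun p => ⟨⟨p.1.1, fun i j => decide (j ∈ p.1.2 i)⟩, ?_⟩
      left_inv := fun p => by simp
      right_inv := fun p => by simp }
  · obtain ⟨⟨k, M⟩, h1, h2⟩ := p
    have hmem : (fun i => Finset.univ.filter fun j => M i j = true) ∈
        unionFamilies d n (Finset.univ : Finset (Fin k)) := by
      simp only [unionFamilies, Finset.mem_filter, Finset.mem_univ, true_and]
      exact ⟨h1, by ext j; simpa using h2 j⟩
    refine Finset.mem_sigma.2 ⟨?_, hmem⟩
    rw [Finset.mem_range]
    by_contra hk
    have := unionFamilies_card_eq_zero (d := d) (n := n) (k := k) (by simp at hk; omega)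
    rw [Finset.card_eq_zero] at this
    simp [this] at hmem
  · obtain ⟨⟨k, f⟩, h⟩ := p
    have h := (Finset.mem_sigma.1 h).2
    simp only [unionFamilies, Finset.mem_filter, Finset.mem_univ, true_and] at h
    refine ⟨fun i => by simpa using h.1 i, fun j => ?_⟩
    have hj := Finset.mem_univ j
    rw [← h.2] at hj
    simpa using hj

lemma hasSum_choose_half (k : ℕ) :
    HasSum (fun m : ℕ => (1 / 2 : ℝ) ^ (m + 1) * m.choose k) 1 := by
  have h := hasSum_choose_mul_geometric_of_norm_lt_one k (r := (1 / 2 : ℝ)) (by norm_num)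
  have h2 := h.mul_left ((1 / 2 : ℝ) ^ (k + 1))
  rw [← hasSum_nat_add_iff' k, Finset.sum_eq_zero fun i hi => by
    rw [Nat.choose_eq_zero_of_lt (Finset.mem_range.1 hi)]; simp]
  convert! h2 using 1
  · funext j
    ring
  · field_simp
    norm_num

lemma hasSum_choose_pow (d n : ℕ) :
    HasSum (fun m : ℕ => (1 / 2 : ℝ) ^ (m + 1) * (m.choose n : ℝ) ^ d)
      (Nat.card {p : (k : ℕ) × (Fin d → Fin k → Bool) //
      (∀ i, (Finset.univ.filter fun j => p.2 i j = true).card = n) ∧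
      (∀ j, ∃ i, p.2 i j = true)} : ℝ) := by
  rw [card_alignments]
  push_cast
  have := hasSum_sum fun (k : ℕ) (_ : k ∈ Finset.range (d * n + 1)) =>
    (hasSum_choose_half k).mul_right
      ((unionFamilies d n (Finset.univ : Finset (Fin k))).card : ℝ)
  simp only [one_mul] at this
  convert! this using 2
  rename_i m
  have h := congrArg (Nat.cast : ℕ → ℝ) (choose_pow_eq_sum d n m)
  push_cast at h
  rw [h, Finset.mul_sum]
  simp only [mul_assoc]

open Filter Topology in
lemma tendsto_div_sub_sq_of_hasDerivAt {f f' : ℝ → ℝ} {a L : ℝ}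
    (hf : ∀ᶠ t in 𝓝 a, HasDerivAt f (f' t) t) (h0 : f a = 0) (h1 : f' a = 0)
    (h2 : HasDerivAt f' L a) :
    Tendsto (fun t => f t / (t - a) ^ 2) (𝓝[≠] a) (𝓝 (L / 2)) := by
  have hne : ∀ᶠ t in 𝓝[≠] a, t - a ≠ 0 := by
    filter_upwards [self_mem_nhdsWithin] with t ht using sub_ne_zero.2 ht
  refine HasDerivAt.lhopital_zero_nhdsNE (f' := f') (g' := fun t => 2 * (t - a))
    (hf.filter_mono nhdsWithin_le_nhds) (Eventually.of_forall fun t => ?_) ?_ ?_ ?_ ?_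
  · convert! ((hasDerivAt_id t).sub_const a).pow 2 using 1
    simp
  · filter_upwards [hne] with t ht using mul_ne_zero two_ne_zero ht
  · exact h0 ▸ hf.self_of_nhds.continuousAt.tendsto.mono_left nhdsWithin_le_nhds
  · have : ContinuousAt (fun t => (t - a) ^ 2) a := by fun_prop
    simpa [ContinuousAt] using this.tendsto.mono_left nhdsWithin_le_nhds
  · have := (hasDerivAt_iff_tendsto_slope.1 h2).div_const 2
    refine this.congr' ?_
    filter_upwards [hne] with t ht
    rw [slope_def_field, h1]
    field_simp
    ring

open Filter Topology in
lemma tendsto_of_tendsto_sqrt_mul_sub {a x : ℝ} {t : ℕ → ℝ}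
    (ht : Tendsto (fun n : ℕ => √n * (t n - a)) atTop (𝓝 x)) : Tendsto t atTop (𝓝 a) := by
  have h1 : Tendsto (fun n : ℕ => (√n)⁻¹) atTop (𝓝 0) :=
    tendsto_inv_atTop_zero.comp (Real.tendsto_sqrt_atTop.comp tendsto_natCast_atTop_atTop)
  have h2 := (h1.mul ht).add_const a
  rw [zero_mul, zero_add] at h2
  refine h2.congr' ?_
  filter_upwards [eventually_gt_atTop 0] with n hn
  have : √(n : ℝ) ≠ 0 := by positivity
  field_simp
  ring

open Filter Topology in
/-- Second order delta method at a critical zero. -/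
lemma tendsto_nat_mul_of_hasDerivAt {f f' : ℝ → ℝ} {a L x : ℝ} {t : ℕ → ℝ}
    (hf : ∀ᶠ t in 𝓝 a, HasDerivAt f (f' t) t) (h0 : f a = 0) (h1 : f' a = 0)
    (h2 : HasDerivAt f' L a)
    (ht : Tendsto (fun n : ℕ => √n * (t n - a)) atTop (𝓝 x)) :
    Tendsto (fun n : ℕ => n * f (t n)) atTop (𝓝 (L / 2 * x ^ 2)) := by
  have hψ := tendsto_div_sub_sq_of_hasDerivAt hf h0 h1 h2
  rw [← continuousAt_update_same] at hψ
  have h3 := (hψ.tendsto.comp (tendsto_of_tendsto_sqrt_mul_sub ht)).mul (ht.pow 2)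
  rw [Function.update_self] at h3
  refine h3.congr fun n => ?_
  simp only [Function.comp_apply, Function.update_apply]
  rw [mul_pow, Real.sq_sqrt (Nat.cast_nonneg n)]
  split_ifs with h
  · simp [h, h0]
  · have : t n - a ≠ 0 := sub_ne_zero.2 h
    field_simp

/-- The negative binomial probability mass function. -/
noncomputable def negBinom (p q : ℝ) (n j : ℕ) : ℝ := (n + j).choose n * q ^ j * p ^ (n + 1)

lemma factorial_eq_stirlingSeq {n : ℕ} (hn : 0 < n) :
    (n.factorial : ℝ) = Stirling.stirlingSeq n * (√(2 * n) * (n / Real.exp 1) ^ n) := by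
  rw [Stirling.stirlingSeq]
  field_simp

/-- The rate function of the negative binomial distribution. -/
noncomputable def negBinomRate (p q t : ℝ) : ℝ :=
  (1 + t) * Real.log (1 + t) - t * Real.log t + t * Real.log q + Real.log p

lemma exp_mul_negBinomRate {p q : ℝ} (hp : 0 < p) (hq : 0 < q) {n j : ℕ} (hn : 0 < n)
    (hj : 0 < j) :
    Real.exp (n * negBinomRate p q (j / n)) =
      ((n + j : ℕ) : ℝ) ^ (n + j) / (n ^ n * j ^ j) * q ^ j * p ^ n := by
  have e : (n : ℝ) * negBinomRate p q (j / n) = (n + j : ℕ) * Real.log (1 + j / n)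
      - j * Real.log (j / n) + j * Real.log q + n * Real.log p := by
    rw [negBinomRate]
    push_cast
    field_simp
  rw [e, Real.exp_add, Real.exp_add, Real.exp_sub]
  simp only [Real.exp_nat_mul]
  rw [Real.exp_log (by positivity), Real.exp_log (by positivity), Real.exp_log hp,
    Real.exp_log hq]
  have : (1 + j / n : ℝ) = (n + j : ℕ) / n := by push_cast; field_simp
  rw [this, div_pow, div_pow, pow_add (n : ℝ) n j]
  field_simp

lemma sqrt_mul_negBinom {p q : ℝ} (hp : 0 < p) (hq : 0 < q) {n j : ℕ} (hn : 0 < n)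
    (hj : 0 < j) :
    √n * negBinom p q n j = Stirling.stirlingSeq (n + j) /
      (Stirling.stirlingSeq n * Stirling.stirlingSeq j) * √((1 + j / n) / (2 * (j / n))) * p *
      Real.exp (n * negBinomRate p q (j / n)) := by
  rw [exp_mul_negBinomRate hp hq hn hj, negBinom, Nat.choose_symm_add, Nat.add_choose, Nat.cast_div
    (Nat.factorial_mul_factorial_dvd_factorial_add n j) (by positivity), Nat.cast_mul,
    factorial_eq_stirlingSeq hn, factorial_eq_stirlingSeq hj,
    factorial_eq_stirlingSeq (Nat.add_pos_left hn j)]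
  have hS : ∀ m : ℕ, 0 < m → Stirling.stirlingSeq m ≠ 0 := fun m hm => by
    obtain ⟨k, rfl⟩ := Nat.exists_eq_succ_of_ne_zero hm.ne'
    exact (Stirling.stirlingSeq'_pos k).ne'
  have h1 := hS n hn
  have h2 := hS j hj
  have hs : √((1 + j / n : ℝ) / (2 * (j / n))) =
      √n * √(2 * (n + j : ℕ)) / (√(2 * n) * √(2 * j)) := by
    rw [← Real.sqrt_mul (by positivity), ← Real.sqrt_mul (by positivity),
      ← Real.sqrt_div (by positivity)]
    congr 1
    push_cast
    field_simp
  rw [hs]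
  simp only [div_pow, pow_add]
  field_simp

open Filter Topology in
/-- Local limit theorem for the negative binomial distribution. -/
lemma tendsto_sqrt_mul_negBinom {p q x : ℝ} (hp : 0 < p) (hq : 0 < q) (hpq : p + q = 1)
    {j : ℕ → ℕ} (hj : Tendsto (fun n : ℕ => √n * ((j n : ℝ) / n - q / p)) atTop (𝓝 x)) :
    Tendsto (fun n : ℕ => √n * negBinom p q n (j n)) atTop
      (𝓝 (p / √(2 * Real.pi * q) * Real.exp (-(p ^ 2 / (2 * q)) * x ^ 2))) := by
  have ht := tendsto_of_tendsto_sqrt_mul_sub hj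
  have ha : 0 < q / p := by positivity
  have h1a : 1 + q / p = 1 / p := by field_simp; linarith
  have hpos : ∀ᶠ n : ℕ in atTop, 0 < n ∧ 0 < j n := by
    filter_upwards [eventually_gt_atTop 0, ht.eventually_const_lt ha] with n hn h
    refine ⟨hn, Nat.pos_of_ne_zero fun h0 => ?_⟩
    simp [h0] at h
  have hjtop : Tendsto j atTop atTop := by
    rw [← tendsto_natCast_atTop_iff (R := ℝ)]
    refine (ht.pos_mul_atTop ha tendsto_natCast_atTop_atTop).congr' ?_
    filter_upwards [eventually_gt_atTop 0] with n hn
    field_simp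
  have hS := Stirling.tendsto_stirlingSeq_sqrt_pi
  have hpi : √Real.pi ≠ 0 := by positivity
  have hS3 := (hS.comp (tendsto_id.atTop_add_atTop hjtop)).div (hS.mul (hS.comp hjtop))
    (mul_ne_zero hpi hpi)
  have hsq := (((ht.const_add 1).div (ht.const_mul 2) (by positivity)).sqrt)
  have hd : ∀ t : ℝ, 0 < t → HasDerivAt (negBinomRate p q)
      (Real.log (1 + t) - Real.log t + Real.log q) t := fun t htp => by
    have h1 : HasDerivAt (fun t : ℝ => 1 + t) 1 t := (hasDerivAt_id t).const_add 1
    have := (((h1.mul (h1.log (by positivity))).sub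
      ((hasDerivAt_id t).mul ((hasDerivAt_id t).log htp.ne'))).add
      ((hasDerivAt_id t).mul_const (Real.log q))).add_const (Real.log p)
    convert! this using 1
    have : 1 + t ≠ 0 := by positivity
    simp only [id]
    field_simp
    ring
  have hd2 : HasDerivAt (fun t => Real.log (1 + t) - Real.log t + Real.log q)
      (-(p ^ 2 / q)) (q / p) := by
    have h1 : HasDerivAt (fun t : ℝ => 1 + t) 1 (q / p) := (hasDerivAt_id _).const_add 1
    have := ((h1.log (by positivity)).sub ((hasDerivAt_id (q / p)).log ha.ne')).add_const
      (Real.log q)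
    convert! this using 1
    simp only [id]
    rw [h1a]
    field_simp
    linear_combination -hpq
  have hE := (tendsto_nat_mul_of_hasDerivAt (f := negBinomRate p q)
    (by filter_upwards [lt_mem_nhds ha] with t htp using hd t htp)
    (by
      rw [negBinomRate, h1a, Real.log_div one_ne_zero hp.ne', Real.log_div hq.ne' hp.ne',
        Real.log_one]
      field_simp
      linear_combination (Real.log p) * hpq)
    (by rw [h1a, Real.log_div one_ne_zero hp.ne', Real.log_div hq.ne' hp.ne', Real.log_one]; ring)
    hd2 hj).rexp
  have hall := ((hS3.mul hsq).mul_const p).mul hE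
  have hlim : √Real.pi / (√Real.pi * √Real.pi) * √((1 + q / p) / (2 * (q / p))) * p *
      Real.exp (-(p ^ 2 / q) / 2 * x ^ 2) =
      p / √(2 * Real.pi * q) * Real.exp (-(p ^ 2 / (2 * q)) * x ^ 2) := by
    have e1 : (1 + q / p) / (2 * (q / p)) = 1 / (2 * q) := by rw [h1a]; field_simp
    have e2 : 2 * Real.pi * q = Real.pi * (2 * q) := by ring
    rw [e1, e2, Real.sqrt_mul Real.pi_pos.le, Real.sqrt_div zero_le_one, Real.sqrt_one]
    congr 1
    · field_simp
    · congr 1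
      field_simp
  rw [hlim] at hall
  refine hall.congr' ?_
  filter_upwards [hpos] with n hn
  rw [sqrt_mul_negBinom hp hq hn.1 hn.2]
  simp

open MeasureTheory

lemma map_floor_volume : (volume : Measure ℝ).map (Int.floor : ℝ → ℤ) = Measure.count := by
  rw [Measure.ext_iff_singleton]
  intro a
  rw [Measure.map_apply Int.measurable_floor (measurableSet_singleton a),
    Int.preimage_floor_singleton]
  simp

lemma integrable_comp_floor_mul {F : ℤ → ℝ} (hF : Summable F) {s : ℝ} (hs : 0 < s) :
    Integrable (fun x : ℝ => F ⌊s * x⌋) := by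
  have h : Integrable F (Measure.map (Int.floor : ℝ → ℤ) volume) := by
    rw [map_floor_volume, integrable_count_iff]
    exact hF.abs
  exact (h.comp_measurable Int.measurable_floor).comp_mul_left' hs.ne'

lemma integral_comp_floor_mul {F : ℤ → ℝ} (hF : Summable F) {s : ℝ} (hs : 0 < s) :
    ∫ x : ℝ, F ⌊s * x⌋ = s⁻¹ * ∑' z, F z := by
  have h : Integrable F (Measure.map (Int.floor : ℝ → ℤ) volume) := by
    rw [map_floor_volume, integrable_count_iff]
    exact hF.abs
  rw [Measure.integral_comp_mul_left (fun x : ℝ => F ⌊x⌋) s, abs_of_pos (inv_pos.2 hs),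
    smul_eq_mul, ← integral_map Int.measurable_floor.aemeasurable h.1, integral_countable h,
    map_floor_volume]
  simp [Measure.real]

open Filter Topology in
/-- A version of Scheffé's lemma for powers of uniformly bounded densities. -/
lemma tendsto_integral_pow_of_tendsto_integral {α : Type*} [MeasurableSpace α] {μ : Measure α}
    {g : ℕ → α → ℝ} {f : α → ℝ} {C : ℝ} (d : ℕ)
    (hg : ∀ᶠ n in atTop, Integrable (g n) μ) (hf : Integrable f μ)
    (hg0 : ∀ n x, 0 ≤ g n x) (hgC : ∀ᶠ n in atTop, ∀ x, g n x ≤ C)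
    (hlim : ∀ x, Tendsto (fun n => g n x) atTop (𝓝 (f x)))
    (hinteg : Tendsto (fun n => ∫ x, g n x ∂μ) atTop (𝓝 (∫ x, f x ∂μ))) :
    Tendsto (fun n => ∫ x, g n x ^ (d + 1) ∂μ) atTop (𝓝 (∫ x, f x ^ (d + 1) ∂μ)) := by
  have hf0 : ∀ x, 0 ≤ f x := fun x => ge_of_tendsto' (hlim x) fun n => hg0 n x
  have hfC : ∀ x, f x ≤ C := fun x => le_of_tendsto (hlim x) (hgC.mono fun n h => h x)
  have hmin : ∀ k : ℕ, Tendsto (fun n => ∫ x, min (g n x) (f x) ^ (k + 1) ∂μ) atTop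
      (𝓝 (∫ x, f x ^ (k + 1) ∂μ)) := fun k => by
    refine tendsto_integral_filter_of_dominated_convergence (fun x => C ^ k * f x) ?_ ?_
      (hf.const_mul _) (Eventually.of_forall fun x => ?_)
    · filter_upwards [hg] with n hn using (hn.inf hf).1.pow _
    · refine Eventually.of_forall fun n => Eventually.of_forall fun x => ?_
      have h0 : 0 ≤ min (g n x) (f x) := le_min (hg0 n x) (hf0 x)
      rw [Real.norm_of_nonneg (by positivity), pow_succ]
      exact mul_le_mul (pow_le_pow_left₀ h0 ((min_le_right _ _).trans (hfC x)) k)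
        (min_le_right _ _) h0 (pow_nonneg ((hf0 x).trans (hfC x)) k)
    · simpa using ((hlim x).min (tendsto_const_nhds (x := f x))).pow (k + 1)
  have hpow : ∀ {h : α → ℝ}, Integrable h μ → (∀ x, 0 ≤ h x) → (∀ x, h x ≤ C) →
      Integrable (fun x => h x ^ (d + 1)) μ := fun {h} hi h0 hC => by
    refine (hi.const_mul (C ^ d)).mono' (hi.1.pow _) (Eventually.of_forall fun x => ?_)
    have := h0 x
    rw [Real.norm_of_nonneg (by positivity), pow_succ]
    exact mul_le_mul_of_nonneg_right (pow_le_pow_left₀ this (hC x) d) this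
  have hm0 := hmin 0
  simp only [zero_add, pow_one] at hm0
  have hdiff : Tendsto (fun n => ∫ x, g n x ^ (d + 1) ∂μ - ∫ x, min (g n x) (f x) ^ (d + 1) ∂μ)
      atTop (𝓝 0) := by
    have hub : Tendsto (fun n => (d + 1) * C ^ d *
        (∫ x, g n x ∂μ - ∫ x, min (g n x) (f x) ∂μ)) atTop (𝓝 0) := by
      simpa using (hinteg.sub hm0).const_mul ((d + 1) * C ^ d)
    refine tendsto_of_tendsto_of_tendsto_of_le_of_le' tendsto_const_nhds hub ?_ ?_ <;>
    · filter_upwards [hg, hgC] with n hn hnC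
      have hi1 := hpow hn (hg0 n) hnC
      have hi2 := hpow (hn.inf hf) (fun x => le_min (hg0 n x) (hf0 x))
        (fun x => (min_le_left _ _).trans (hnC x))
      have hle : ∀ x, min (g n x) (f x) ^ (d + 1) ≤ g n x ^ (d + 1) := fun x =>
        pow_le_pow_left₀ (le_min (hg0 n x) (hf0 x)) (min_le_left _ _) _
      first
      | exact sub_nonneg.2 (integral_mono hi2 hi1 hle)
      | change _ - ∫ x, (g n ⊓ f) x ^ (d + 1) ∂μ ≤ (d + 1) * C ^ d * (_ - ∫ x, (g n ⊓ f) x ∂μ)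
        rw [← integral_sub hi1 hi2, ← integral_sub hn (hn.inf hf), ← integral_const_mul]
        refine integral_mono (hi1.sub hi2) ((hn.sub (hn.inf hf)).const_mul _) fun x => ?_
        have h0 : 0 ≤ min (g n x) (f x) := le_min (hg0 n x) (hf0 x)
        have hl := min_le_left (g n x) (f x)
        have hb := abs_pow_sub_pow_le (g n x) (min (g n x) (f x)) (d + 1)
        rw [abs_of_nonneg (sub_nonneg.2 (hle x)), abs_of_nonneg (sub_nonneg.2 hl),
          abs_of_nonneg (hg0 n x), abs_of_nonneg h0, max_eq_left hl] at hb
        simp only [Nat.add_sub_cancel, Nat.cast_add, Nat.cast_one] at hb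
        refine hb.trans ?_
        have := pow_le_pow_left₀ (hg0 n x) (hnC x) d
        have h3 := sub_nonneg.2 hl
        change _ ≤ (d + 1) * C ^ d * (g n x - min (g n x) (f x))
        rw [mul_comm (g n x - _), mul_assoc, mul_assoc, mul_comm (g n x - _)]
        gcongr
  simpa using hdiff.add (hmin d)

lemma hasSum_int_extend {G : ℕ → ℝ} {s : ℝ} (h : HasSum G s) (a : ℤ) :
    HasSum (fun z : ℤ => if 0 ≤ a + z then G (a + z).toNat else 0) s := by
  have hinj : Function.Injective (fun j : ℕ => (j : ℤ) - a) := fun i j hij => by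
    simp only at hij
    omega
  rw [← hinj.hasSum_iff]
  · convert! h using 1
    funext j
    simp
  · intro z hz
    rw [if_neg]
    exact fun h0 => hz ⟨(a + z).toNat, by simp only; omega⟩

lemma negBinom_nonneg {p q : ℝ} (hp : 0 < p) (hq : 0 < q) (n j : ℕ) :
    0 ≤ negBinom p q n j := by
  unfold negBinom
  positivity

lemma hasSum_negBinom {p q : ℝ} (hp : 0 < p) (hq : 0 < q) (hpq : p + q = 1) (n : ℕ) :
    HasSum (negBinom p q n) 1 := by
  have h := (hasSum_choose_mul_geometric_of_norm_lt_one n (r := q)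
    (by rw [Real.norm_of_nonneg hq.le]; linarith)).mul_right (p ^ (n + 1))
  rw [show 1 - q = p by linarith, one_div_mul_cancel (by positivity)] at h
  convert! h using 2
  rw [negBinom, add_comm n]

lemma negBinom_succ_mul (p q : ℝ) (n j : ℕ) :
    negBinom p q n (j + 1) * (j + 1) = negBinom p q n j * (q * (n + j + 1)) := by
  have h := Nat.choose_mul_succ_eq (n + j) n
  rw [show n + j + 1 - n = j + 1 by omega] at h
  have h' := congrArg (Nat.cast : ℕ → ℝ) h
  push_cast at h'
  rw [negBinom, negBinom, ← add_assoc n j 1, pow_succ]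
  linear_combination (-(q ^ j * q * p ^ (n + 1))) * h'

lemma negBinom_le_mode {p q : ℝ} (hp : 0 < p) (hq : 0 < q) (hpq : p + q = 1) (n j : ℕ) :
    negBinom p q n j ≤ negBinom p q n ⌊n * q / p⌋₊ := by
  have hx : 0 ≤ n * q / p := by positivity
  rcases le_total j ⌊n * q / p⌋₊ with h | h
  · suffices ∀ m, j ≤ m → m ≤ ⌊n * q / p⌋₊ → negBinom p q n j ≤ negBinom p q n m from
      this _ h le_rfl
    intro m hm
    induction m, hm using Nat.le_induction with
    | base => exact fun _ => le_rfl
    | succ m hm ih =>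
      intro hm1
      refine (ih (by omega)).trans ?_
      have h1 := (Nat.le_floor_iff hx).1 hm1
      rw [le_div_iff₀ hp] at h1
      push_cast at h1
      refine le_of_mul_le_mul_right ?_ (show (0 : ℝ) < m + 1 by positivity)
      rw [negBinom_succ_mul]
      refine mul_le_mul_of_nonneg_left ?_ (negBinom_nonneg hp hq n m)
      have : p = 1 - q := by linarith
      subst this
      linarith
  · induction j, h using Nat.le_induction with
    | base => exact le_rfl
    | succ m hm ih =>
      refine le_trans ?_ ih
      have h1 : n * q / p < m + 1 := (Nat.lt_floor_add_one _).trans_le (by gcongr)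
      rw [div_lt_iff₀ hp] at h1
      refine le_of_mul_le_mul_right ?_ (show (0 : ℝ) < m + 1 by positivity)
      rw [negBinom_succ_mul]
      refine mul_le_mul_of_nonneg_left ?_ (negBinom_nonneg hp hq n m)
      have : p = 1 - q := by linarith
      subst this
      linarith

lemma summable_negBinom_pow {p q : ℝ} (hp : 0 < p) (hq : 0 < q) (hpq : p + q = 1) (n k : ℕ) :
    Summable (fun j => negBinom p q n j ^ (k + 1)) := by
  refine Summable.of_nonneg_of_le (fun j => pow_nonneg (negBinom_nonneg hp hq n j) _)
    (fun j => ?_) ((hasSum_negBinom hp hq hpq n).summable.mul_left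
      (negBinom p q n ⌊n * q / p⌋₊ ^ k))
  rw [pow_succ]
  have := negBinom_nonneg hp hq n j
  gcongr
  exact negBinom_le_mode hp hq hpq n j

/-- The negative binomial density, extended to the integers and centered at its mode. -/
noncomputable def centeredNegBinom (p q : ℝ) (n : ℕ) (z : ℤ) : ℝ :=
  if 0 ≤ (⌊n * q / p⌋₊ : ℤ) + z then negBinom p q n (⌊n * q / p⌋₊ + z).toNat else 0

lemma hasSum_centeredNegBinom_pow {p q : ℝ} (hp : 0 < p) (hq : 0 < q) (hpq : p + q = 1)
    (n k : ℕ) :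
    HasSum (fun z => centeredNegBinom p q n z ^ (k + 1))
      (∑' j, negBinom p q n j ^ (k + 1)) := by
  convert! hasSum_int_extend (summable_negBinom_pow hp hq hpq n k).hasSum ⌊n * q / p⌋₊ using 2
  rw [centeredNegBinom]
  split_ifs <;> simp

open Filter Topology in
lemma tendsto_sqrt_mul_centeredNegBinom {p q : ℝ} (hp : 0 < p) (hq : 0 < q) (hpq : p + q = 1)
    (x : ℝ) :
    Tendsto (fun n : ℕ => √n * centeredNegBinom p q n ⌊√n * x⌋) atTop
      (𝓝 (p / √(2 * Real.pi * q) * Real.exp (-(p ^ 2 / (2 * q)) * x ^ 2))) := by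
  have hsq : Tendsto (fun n : ℕ => √(n : ℝ)) atTop atTop :=
    Real.tendsto_sqrt_atTop.comp tendsto_natCast_atTop_atTop
  have ha : 0 < q / p := by positivity
  have hnn : ∀ᶠ n : ℕ in atTop, 0 ≤ (⌊n * q / p⌋₊ : ℤ) + ⌊√n * x⌋ := by
    have h := hsq.atTop_mul_atTop₀
      (tendsto_atTop_add_const_right _ x (hsq.atTop_mul_const ha))
    filter_upwards [h.eventually_ge_atTop 2] with n hn
    have h1 := Nat.lt_floor_add_one (n * q / p)
    have h2 := Int.lt_floor_add_one (√n * x)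
    have h3 : √(n : ℝ) * √n = n := Real.mul_self_sqrt (Nat.cast_nonneg n)
    have h4 : √(n : ℝ) * (√n * (q / p) + x) = n * q / p + √n * x := by
      linear_combination (q / p) * h3
    have : (0 : ℝ) < ((⌊n * q / p⌋₊ : ℤ) + ⌊√n * x⌋ : ℤ) + 1 := by
      push_cast
      linarith
    exact Int.lt_add_one_iff.1 (by exact_mod_cast this)
  have hj : Tendsto (fun n : ℕ =>
      √n * ((((⌊n * q / p⌋₊ : ℤ) + ⌊√n * x⌋).toNat : ℝ) / n - q / p)) atTop (𝓝 x) := by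
    have hinv : Tendsto (fun n : ℕ => (√(n : ℝ))⁻¹) atTop (𝓝 0) :=
      tendsto_inv_atTop_zero.comp hsq
    have hlow : Tendsto (fun n : ℕ => x - 2 * (√(n : ℝ))⁻¹) atTop (𝓝 x) := by
      simpa using (hinv.const_mul 2).const_sub x
    refine tendsto_of_tendsto_of_tendsto_of_le_of_le' hlow tendsto_const_nhds ?_ ?_ <;>
    · filter_upwards [hnn, eventually_gt_atTop 0] with n hn hn0
      have hs : 0 < √(n : ℝ) := by positivity
      have h0 : ((((⌊n * q / p⌋₊ : ℤ) + ⌊√n * x⌋).toNat : ℕ) : ℝ) =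
          (⌊n * q / p⌋₊ : ℝ) + (⌊√n * x⌋ : ℝ) := by
        have := Int.toNat_of_nonneg hn
        exact_mod_cast congrArg (Int.cast : ℤ → ℝ) this
      have h1 := Nat.lt_floor_add_one (n * q / p)
      have h1' := Nat.floor_le (show 0 ≤ n * q / p by positivity)
      have h2 := Int.lt_floor_add_one (√n * x)
      have h2' := Int.floor_le (√n * x)
      have h3 : √(n : ℝ) * √n = n := Real.mul_self_sqrt (Nat.cast_nonneg n)
      rw [h0]
      refine le_of_mul_le_mul_left ?_ hs
      have h4 : √(n : ℝ) * (√n * (((⌊n * q / p⌋₊ : ℝ) + (⌊√n * x⌋ : ℝ)) / n - q / p)) =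
          (⌊n * q / p⌋₊ : ℝ) + (⌊√n * x⌋ : ℝ) - n * q / p := by
        rw [← mul_assoc, h3]
        field_simp
      have h5 : √(n : ℝ) * (x - 2 * (√(n : ℝ))⁻¹) = √n * x - 2 := by
        field_simp
      rw [h4]
      linarith
  refine (tendsto_sqrt_mul_negBinom hp hq hpq hj).congr' ?_
  filter_upwards [hnn] with n hn
  rw [centeredNegBinom, if_pos hn]

open Filter Topology MeasureTheory in
lemma tendsto_tsum_negBinom_pow {p q : ℝ} (hp : 0 < p) (hq : 0 < q) (hpq : p + q = 1) (k : ℕ) :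
    Tendsto (fun n : ℕ => √n ^ k * ∑' j, negBinom p q n j ^ (k + 1)) atTop
      (𝓝 ((p / √(2 * Real.pi * q)) ^ (k + 1) *
        √(Real.pi / ((k + 1 : ℕ) * (p ^ 2 / (2 * q)))))) := by
  have hb : 0 < p ^ 2 / (2 * q) := by positivity
  have hinteg : ∀ (n m : ℕ), 0 < n →
      Integrable (fun x : ℝ => (√n * centeredNegBinom p q n ⌊√n * x⌋) ^ (m + 1)) ∧
      ∫ x : ℝ, (√n * centeredNegBinom p q n ⌊√n * x⌋) ^ (m + 1) =
        √n ^ m * ∑' j, negBinom p q n j ^ (m + 1) := fun n m hn => by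
    have hs : 0 < √(n : ℝ) := by positivity
    have h := hasSum_centeredNegBinom_pow hp hq hpq n m
    simp only [mul_pow]
    refine ⟨(integrable_comp_floor_mul h.summable hs).const_mul _, ?_⟩
    rw [integral_const_mul,
      integral_comp_floor_mul (F := fun z => centeredNegBinom p q n z ^ (m + 1)) h.summable hs,
      h.tsum_eq, pow_succ]
    field_simp
  have hlim := tendsto_sqrt_mul_centeredNegBinom hp hq hpq
  have hnn : ∀ n z, 0 ≤ centeredNegBinom p q n z := fun n z => by
    rw [centeredNegBinom]
    split_ifs
    exacts [negBinom_nonneg hp hq _ _, le_rfl]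
  have hmode : ∀ n z, centeredNegBinom p q n z ≤ centeredNegBinom p q n 0 := fun n z => by
    have : centeredNegBinom p q n 0 = negBinom p q n ⌊n * q / p⌋₊ := by
      simp [centeredNegBinom]
    rw [this, centeredNegBinom]
    split_ifs
    exacts [negBinom_le_mode hp hq hpq _ _, negBinom_nonneg hp hq _ _]
  have hmain := tendsto_integral_pow_of_tendsto_integral (μ := volume)
    (g := fun (n : ℕ) (x : ℝ) => √n * centeredNegBinom p q n ⌊√n * x⌋)
    (C := p / √(2 * Real.pi * q) + 1) k
    (by
      filter_upwards [eventually_gt_atTop 0] with n hn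
      simpa using (hinteg n 0 hn).1)
    ((integrable_exp_neg_mul_sq hb).const_mul _)
    (fun n x => mul_nonneg (Real.sqrt_nonneg _) (hnn n _))
    (by
      have h0 := hlim 0
      simp only [mul_zero, Int.floor_zero, ne_eq, OfNat.ofNat_ne_zero, not_false_eq_true,
        zero_pow, Real.exp_zero, mul_one] at h0
      filter_upwards [h0.eventually_le_const (lt_add_one _)] with n hn x
      exact (mul_le_mul_of_nonneg_left (hmode n _) (Real.sqrt_nonneg _)).trans hn)
    hlim
    (by
      rw [integral_const_mul, integral_gaussian]
      have h1 : p / √(2 * Real.pi * q) * √(Real.pi / (p ^ 2 / (2 * q))) = 1 := by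
        have : Real.pi / (p ^ 2 / (2 * q)) = (2 * Real.pi * q) / p ^ 2 := by field_simp
        rw [this, Real.sqrt_div (by positivity), Real.sqrt_sq hp.le]
        field_simp
      rw [h1]
      refine tendsto_const_nhds.congr' ?_
      filter_upwards [eventually_gt_atTop 0] with n hn
      have := (hinteg n 0 hn).2
      simp only [zero_add, pow_one, pow_zero, one_mul,
        (hasSum_negBinom hp hq hpq n).tsum_eq] at this
      exact this.symm)
  have hgauss : ∫ x : ℝ, (p / √(2 * Real.pi * q) * Real.exp (-(p ^ 2 / (2 * q)) * x ^ 2)) ^ (k + 1)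
      = (p / √(2 * Real.pi * q)) ^ (k + 1) *
        √(Real.pi / ((k + 1 : ℕ) * (p ^ 2 / (2 * q)))) := by
    simp only [mul_pow, ← Real.exp_nat_mul]
    rw [integral_const_mul, ← integral_gaussian]
    congr! 4
    ring
  rw [hgauss] at hmain
  refine hmain.congr' ?_
  filter_upwards [eventually_gt_atTop 0] with n hn using (hinteg n k hn).2

lemma card_alignments_eq_tsum {p q : ℝ} (hp : 0 < p) {d : ℕ} (hqd : q ^ d = 1 / 2) (hd : d ≠ 0)
    (n : ℕ) :
    (Nat.card {p : (k : ℕ) × (Fin d → Fin k → Bool) //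
      (∀ i, (Finset.univ.filter fun j => p.2 i j = true).card = n) ∧
      (∀ j, ∃ i, p.2 i j = true)} : ℝ) =
    1 / 2 * q ^ (d * n) / p ^ (d * n + d) * ∑' j, negBinom p q n j ^ d := by
  have h := hasSum_choose_pow d n
  rw [← hasSum_nat_add_iff' n, Finset.sum_eq_zero fun i hi => by
    rw [Nat.choose_eq_zero_of_lt (Finset.mem_range.1 hi)]; simp [hd], sub_zero] at h
  rw [← h.tsum_eq, ← tsum_mul_left]
  congr 1
  funext j
  rw [negBinom, mul_pow, mul_pow, ← pow_mul p, ← pow_mul q, mul_comm j d, pow_mul q d j,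
    pow_mul q d n, hqd, add_comm j n, show (n + 1) * d = d * n + d by ring]
  field_simp
  ring

lemma sqrt_pow {x : ℝ} (hx : 0 ≤ x) (k : ℕ) : √(x ^ k) = √x ^ k := by
  rw [Real.sqrt_eq_iff_mul_self_eq (by positivity) (by positivity), ← mul_pow,
    Real.mul_self_sqrt hx]

/-- Let A_d(n) be the number of (d, n,…,n)-alignments: pairs (k, M) with M a
d×k binary matrix whose rows each sum to n and with no zero column. Then
A_d(n) ~ (2^{1/d} − 1)^{−dn} / ((2^{1/d} − 1)·2^{(d²−1)/(2d)}·√(d·(πn)^{d−1})). -/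
theorem stmt17 (d : ℕ) (hd : 2 ≤ d) (A : ℕ → ℕ)
    (hA : ∀ n : ℕ, A n = Nat.card {p : (k : ℕ) × (Fin d → Fin k → Bool) //
      (∀ i, (Finset.univ.filter fun j => p.2 i j = true).card = n) ∧
      (∀ j, ∃ i, p.2 i j = true)}) :
    Filter.Tendsto (fun n : ℕ => (A n : ℝ) /
        (((2 : ℝ) ^ ((1 : ℝ) / d) - 1) ^ (-((d * n : ℕ) : ℤ)) *
          (1 / (((2 : ℝ) ^ ((1 : ℝ) / d) - 1) *
            (2 : ℝ) ^ (((d : ℝ) ^ 2 - 1) / (2 * d)) *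
            Real.sqrt (d * (Real.pi * n) ^ (d - 1))))))
      Filter.atTop (nhds 1) := by
  obtain ⟨k, rfl⟩ : ∃ k, d = k + 1 := ⟨d - 1, by omega⟩
  set D : ℝ := ((k + 1 : ℕ) : ℝ) with hD
  have hD0 : 0 < D := by positivity
  set q : ℝ := (2 : ℝ) ^ (-(1 / D)) with hq_def
  have hq : 0 < q := by positivity
  have hqd : q ^ (k + 1) = 1 / 2 := by
    rw [hq_def, ← Real.rpow_natCast, ← Real.rpow_mul zero_le_two, ← hD]
    rw [show -(1 / D) * D = -1 by field_simp, Real.rpow_neg_one]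
    norm_num
  have hq1 : q < 1 := Real.rpow_lt_one_of_one_lt_of_neg one_lt_two (by simpa using hD0)
  obtain ⟨p, hpq⟩ : ∃ p, p + q = 1 := ⟨1 - q, by ring⟩
  have hp : 0 < p := by linarith
  have hc : (2 : ℝ) ^ (1 / D) - 1 = p / q := by
    have : (2 : ℝ) ^ (1 / D) = 1 / q := by
      rw [hq_def, Real.rpow_neg zero_le_two, one_div, one_div, inv_inv]
    rw [this]
    field_simp
    linarith
  have hpow : (2 : ℝ) ^ ((D ^ 2 - 1) / (2 * D)) = √2 ^ (k + 1) * √q := by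
    rw [Real.sqrt_eq_rpow, Real.sqrt_eq_rpow, hq_def, ← Real.rpow_mul zero_le_two,
      ← Real.rpow_natCast (2 ^ (1 / 2 : ℝ)), ← Real.rpow_mul zero_le_two,
      ← Real.rpow_add two_pos, ← hD]
    congr 1
    field_simp
    ring
  have hsq : √q ^ (k + 1) = 1 / √2 := by
    rw [← sqrt_pow hq.le, hqd, Real.sqrt_div zero_le_one, Real.sqrt_one]
  have hlim := (tendsto_tsum_negBinom_pow hp hq hpq k).const_mul
    (1 / 2 / p ^ (k + 1) * (p / q) * (√2 ^ (k + 1) * √q) * (√D * √Real.pi ^ k))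
  have h22 : √(2 : ℝ) * √2 = 2 := Real.mul_self_sqrt zero_le_two
  have hqq : √q * √q = q := Real.mul_self_sqrt hq.le
  have hone : 1 / 2 / p ^ (k + 1) * (p / q) * (√2 ^ (k + 1) * √q) * (√D * √Real.pi ^ k) *
      ((p / √(2 * Real.pi * q)) ^ (k + 1) * √(Real.pi / (D * (p ^ 2 / (2 * q))))) = 1 := by
    have e1 : √(2 * Real.pi * q) = √2 * √Real.pi * √q := by
      rw [Real.sqrt_mul (by positivity), Real.sqrt_mul zero_le_two]
    have e2 : √(Real.pi / (D * (p ^ 2 / (2 * q)))) = √2 * √Real.pi * √q / (√D * p) := by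
      rw [← e1, show Real.pi / (D * (p ^ 2 / (2 * q))) = 2 * Real.pi * q / (D * p ^ 2) by
        field_simp, Real.sqrt_div (by positivity), Real.sqrt_mul hD0.le, Real.sqrt_sq hp.le]
    rw [e1, e2, div_pow, mul_pow, mul_pow, hsq]
    have : √D ≠ 0 := by positivity
    field_simp
    linear_combination (√Real.pi * √Real.pi ^ k) * (√2 ^ 2 * hqq + q * h22)
  rw [hone] at hlim
  refine hlim.congr' ?_
  filter_upwards [Filter.eventually_gt_atTop 0] with n hn
  have hn' : (0 : ℝ) < n := by positivity
  rw [hA, card_alignments_eq_tsum hp hqd k.succ_ne_zero, hc, hpow, zpow_neg, zpow_natCast,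
    Nat.add_sub_cancel, Real.sqrt_mul hD0.le, sqrt_pow (by positivity),
    Real.sqrt_mul Real.pi_pos.le, mul_pow, div_pow, pow_add p]
  have : √D ≠ 0 := by positivity
  field_simp
  ring
end

section
/- Let d ≥ 2 and b ≥ 1 be integers and define j : ℝ → ℝ by j(x) = 1 − x^d − ( (1 + x)^d − 1 − x^d ) · ( 1 − x^d + x^{bd} ). Then j(x) < 0 for every real x ≥ 1, and there exists c ∈ (0,1) with j(c) = 0. -/
lemma one_add_pow_lt_one_add_pow {x : ℝ} (hx : 0 < x) {d : ℕ} (hd : 2 ≤ d) :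
    1 + x ^ d < (1 + x) ^ d := by
  obtain ⟨k, rfl⟩ := Nat.exists_eq_add_of_le' hd
  have h₁ : 1 < (1 + x) ^ (k + 1) := one_lt_pow₀ (by linarith) (by omega)
  have h₂ : x ^ (k + 1) ≤ (1 + x) ^ (k + 1) := pow_le_pow_left₀ hx.le (by linarith) _
  calc 1 + x ^ (k + 2) = 1 + x * x ^ (k + 1) := by ring
    _ < (1 + x) ^ (k + 1) + x * (1 + x) ^ (k + 1) :=
      add_lt_add_of_lt_of_le h₁ (mul_le_mul_of_nonneg_left h₂ hx.le)
    _ = (1 + x) ^ (k + 2) := by ring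

/-- For j(x) = 1 − x^d − ((1+x)^d − 1 − x^d)·(1 − x^d + x^{bd}) (the diagonal
restriction of the denominator for alignments with blocks of size ≥ b):
j(x) < 0 for all x ≥ 1, and j has a root c ∈ (0,1). -/
theorem stmt19 (d b : ℕ) (hd : 2 ≤ d) (hb : 1 ≤ b)
    (j : ℝ → ℝ)
    (hj : ∀ x : ℝ, j x = 1 - x ^ d -
      ((1 + x) ^ d - 1 - x ^ d) * (1 - x ^ d + x ^ (b * d))) :
    (∀ x : ℝ, 1 ≤ x → j x < 0) ∧ ∃ c ∈ Set.Ioo (0 : ℝ) 1, j c = 0 := by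
  have neg : ∀ x : ℝ, 1 ≤ x → j x < 0 := fun x hx => by
    have ht : 1 ≤ x ^ d := one_le_pow₀ hx
    have hp := one_add_pow_lt_one_add_pow (zero_lt_one.trans_le hx) hd
    have htb : x ^ d ≤ x ^ (b * d) := pow_le_pow_right₀ hx (Nat.le_mul_of_pos_left d hb)
    have hprod : 0 < ((1 + x) ^ d - 1 - x ^ d) * (1 - x ^ d + x ^ (b * d)) :=
      mul_pos (by linarith) (by linarith)
    rw [hj]
    linarith
  refine ⟨neg, ?_⟩
  have hcont : Continuous j := by
    rw [funext hj]
    fun_prop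
  have h₀ : 0 < j 0 := by
    have hd₀ : d ≠ 0 := by omega
    simp [hj, hd₀]
  exact intermediate_value_Ioo' zero_le_one hcont.continuousOn ⟨neg 1 le_rfl, h₀⟩
end
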